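/- arXiv:1501.01328 — 2 statements merged into one kernel-verified Lean document; each statement's English description precedes it below -/
import Mathlib

section
/- Let Ω be a functorially finite resolving subcategory of A-mod such that for some positive integer n the cardinal 𝔑 of isomorphism classes of indecomposable modules in Ω of length n satisfies 𝔑 ≥ ℵ₀. Then there are infinitely many positive integers k such that the cardinal of isomorphism classes of indecomposable modules in Ω of length k is at least 𝔑. -/
open CategoryTheory Limits

universe u

section Base
variable {A : Type} [Ring A]

/-- An object of `ModuleCat A` is indecomposable. -/
def Indec (X : ModuleCat.{0} A) : Prop :=
  Nontrivial X ∧ ∀ e : X ⟶ X, e ≫ e = e → e = 0 ∨ e = 𝟙 X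

/-- `f` is irreducible with respect to the subcategory `χ`. -/
def IrredIn (χ : ModuleCat.{0} A → Prop) {X Y : ModuleCat.{0} A} (f : X ⟶ Y) : Prop :=
  ¬ IsSplitMono f ∧ ¬ IsSplitEpi f ∧
    ∀ (Z : ModuleCat.{0} A), χ Z → ∀ (h : X ⟶ Z) (g : Z ⟶ Y), f = h ≫ g →
      IsSplitMono h ∨ IsSplitEpi g

def RightAlmostSplitIn (χ : ModuleCat.{0} A → Prop) {X Y : ModuleCat.{0} A} (f : X ⟶ Y) : Prop :=
  ¬ IsSplitEpi f ∧ ∀ (Z : ModuleCat.{0} A), χ Z → ∀ g : Z ⟶ Y, ¬ IsSplitEpi g →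
    ∃ h : Z ⟶ X, h ≫ f = g

def LeftAlmostSplitIn (χ : ModuleCat.{0} A → Prop) {X Y : ModuleCat.{0} A} (f : X ⟶ Y) : Prop :=
  ¬ IsSplitMono f ∧ ∀ (Z : ModuleCat.{0} A), χ Z → ∀ g : X ⟶ Z, ¬ IsSplitMono g →
    ∃ h : Y ⟶ Z, f ≫ h = g

def RightMinimal {X Y : ModuleCat.{0} A} (f : X ⟶ Y) : Prop :=
  ∀ h : X ⟶ X, h ≫ f = f → IsIso h

def LeftMinimal {X Y : ModuleCat.{0} A} (f : X ⟶ Y) : Prop :=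
  ∀ h : Y ⟶ Y, f ≫ h = f → IsIso h

def MinimalRightAlmostSplitIn (χ : ModuleCat.{0} A → Prop) {X Y : ModuleCat.{0} A}
    (f : X ⟶ Y) : Prop :=
  RightMinimal f ∧ RightAlmostSplitIn χ f

def MinimalLeftAlmostSplitIn (χ : ModuleCat.{0} A → Prop) {X Y : ModuleCat.{0} A}
    (f : X ⟶ Y) : Prop :=
  LeftMinimal f ∧ LeftAlmostSplitIn χ f

/-- `0 → X → Y → Z → 0` is a short exact sequence. -/
def IsSES {X Y Z : ModuleCat.{0} A} (f : X ⟶ Y) (g : Y ⟶ Z) : Prop :=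
  Function.Injective f ∧ Function.Surjective g ∧ Function.Exact f g

/-- `0 → X → Y → Z → 0` is an almost split sequence in `χ`. -/
def IsAlmostSplitSeq (χ : ModuleCat.{0} A → Prop) {X Y Z : ModuleCat.{0} A}
    (f : X ⟶ Y) (g : Y ⟶ Z) : Prop :=
  IsSES f g ∧ MinimalLeftAlmostSplitIn χ f ∧ MinimalRightAlmostSplitIn χ g

/-- `f : X → Y` is a right `χ`-approximation of `Y`. -/
def RightApprox (χ : ModuleCat.{0} A → Prop) {X Y : ModuleCat.{0} A} (f : X ⟶ Y) : Prop :=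
  χ X ∧ ∀ (Z : ModuleCat.{0} A), χ Z → ∀ g : Z ⟶ Y, ∃ h : Z ⟶ X, h ≫ f = g

def LeftApprox (χ : ModuleCat.{0} A → Prop) {X Y : ModuleCat.{0} A} (f : X ⟶ Y) : Prop :=
  χ Y ∧ ∀ (Z : ModuleCat.{0} A), χ Z → ∀ g : X ⟶ Z, ∃ h : Y ⟶ Z, f ≫ h = g

def MinimalRightApprox (χ : ModuleCat.{0} A → Prop) {X Y : ModuleCat.{0} A} (f : X ⟶ Y) : Prop :=
  RightApprox χ f ∧ RightMinimal f

def ContravariantlyFinite (χ : ModuleCat.{0} A → Prop) : Prop :=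
  ∀ Y : ModuleCat.{0} A, Module.Finite A Y → ∃ (X : ModuleCat.{0} A) (f : X ⟶ Y), RightApprox χ f

def CovariantlyFinite (χ : ModuleCat.{0} A → Prop) : Prop :=
  ∀ X : ModuleCat.{0} A, Module.Finite A X → ∃ (Y : ModuleCat.{0} A) (f : X ⟶ Y), LeftApprox χ f

def FunctoriallyFinite (χ : ModuleCat.{0} A → Prop) : Prop :=
  ContravariantlyFinite χ ∧ CovariantlyFinite χ

/-- `χ` is a subcategory of `A`-mod: its objects are finitely generated, and it is
closed under isomorphisms, finite direct sums and direct summands. -/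
def IsSubcat (χ : ModuleCat.{0} A → Prop) : Prop :=
  (∀ X : ModuleCat.{0} A, χ X → Module.Finite A X) ∧
  (∀ X Y : ModuleCat.{0} A, (X ≅ Y) → χ X → χ Y) ∧
  (∀ X Y : ModuleCat.{0} A, χ X → χ Y → χ (X ⊞ Y)) ∧
  (∀ X Y Z : ModuleCat.{0} A, (X ≅ Y ⊞ Z) → χ X → χ Y)

def ClosedUnderExtensions (χ : ModuleCat.{0} A → Prop) : Prop :=
  ∀ (X Y Z : ModuleCat.{0} A) (f : X ⟶ Y) (g : Y ⟶ Z), IsSES f g → χ X → χ Z → χ Y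

def ContainsProjectives (χ : ModuleCat.{0} A → Prop) : Prop :=
  ∀ P : ModuleCat.{0} A, Module.Finite A P → Projective P → χ P

/-- `Ω` is a resolving subcategory: closed under extensions, contains `A`, and is closed
under kernels of epimorphisms. -/
def Resolving (Ω : ModuleCat.{0} A → Prop) : Prop :=
  ClosedUnderExtensions Ω ∧ Ω (ModuleCat.of A A) ∧
  (∀ (X Y K : ModuleCat.{0} A) (f : X ⟶ Y) (i : K ⟶ X), Ω X → Ω Y →
    Function.Surjective f → Function.Injective i → Function.Exact i f → Ω K)

/-- `n` is the Jordan–Hölder length of the module `X`. -/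
def IsJHLength (X : ModuleCat.{0} A) (n : ℕ) : Prop :=
  ∃ s : CompositionSeries (Submodule A X), s.head = ⊥ ∧ s.last = ⊤ ∧ s.length = n

end Base

/-- The setoid identifying isomorphic objects satisfying `P`. -/
def isoSetoid {A : Type} [Ring A] (P : ModuleCat.{0} A → Prop) :
    Setoid {X : ModuleCat.{0} A // P X} where
  r X Y := Nonempty (X.1 ≅ Y.1)
  iseqv := ⟨fun _ => ⟨Iso.refl _⟩, fun ⟨e⟩ => ⟨e.symm⟩, fun ⟨e⟩ ⟨e'⟩ => ⟨e.trans e'⟩⟩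

/-- The cardinal of isomorphism classes of indecomposable modules in `Ω` of
Jordan–Hölder length `k`. -/
noncomputable def numIndecOfLength {A : Type} [Ring A] (Ω : ModuleCat.{0} A → Prop)
    (len : ModuleCat.{0} A → ℕ) (k : ℕ) : Cardinal :=
  Cardinal.mk (Quotient (isoSetoid (fun X => Ω X ∧ Indec X ∧ len X = k)))

section Length

variable {A : Type} [Ring A]

/-- The length of a module as a natural number (`0` if the length is infinite). -/
noncomputable def natLength (A : Type) [Ring A] (X : Type) [AddCommGroup X] [Module A X] : ℕ :=
  (Module.length A X).toNat

variable [IsArtinianRing A]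
  {X Y Z : Type} [AddCommGroup X] [Module A X] [AddCommGroup Y] [Module A Y]
  [AddCommGroup Z] [Module A Z]

lemma coe_natLength [Module.Finite A X] : (natLength A X : ℕ∞) = Module.length A X :=
  ENat.natCast_toNat Module.length_ne_top

lemma natLength_eq_add_of_exact [Module.Finite A Y] (f : X →ₗ[A] Y) (g : Y →ₗ[A] Z)
    (hf : Function.Injective f) (hg : Function.Surjective g) (H : Function.Exact f g) :
    natLength A Y = natLength A X + natLength A Z := by
  have : Module.Finite A X := Module.Finite.of_injective f hf
  have : Module.Finite A Z := Module.Finite.of_surjective g hg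
  have h := Module.length_eq_add_of_exact f g hf hg H
  rw [← coe_natLength, ← coe_natLength, ← coe_natLength] at h
  exact_mod_cast h

lemma natLength_eq_range_add_ker [Module.Finite A X] (f : X →ₗ[A] Y) :
    natLength A X = natLength A (LinearMap.ker f) + natLength A (LinearMap.range f) :=
  natLength_eq_add_of_exact (LinearMap.ker f).subtype f.rangeRestrict
    (LinearMap.ker f).injective_subtype f.surjective_rangeRestrict
    (by rw [LinearMap.exact_iff]; simp)

lemma natLength_le_of_injective [Module.Finite A Y] (f : X →ₗ[A] Y) (hf : Function.Injective f) :
    natLength A X ≤ natLength A Y := by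
  have : Module.Finite A X := Module.Finite.of_injective f hf
  have h := Module.length_le_of_injective f hf
  rw [← coe_natLength, ← coe_natLength] at h
  exact_mod_cast h

lemma natLength_le_of_surjective [Module.Finite A X] (f : X →ₗ[A] Y) (hf : Function.Surjective f) :
    natLength A Y ≤ natLength A X := by
  have : Module.Finite A Y := Module.Finite.of_surjective f hf
  have h := Module.length_le_of_surjective f hf
  rw [← coe_natLength, ← coe_natLength] at h
  exact_mod_cast h

omit [IsArtinianRing A] in
lemma LinearEquiv.natLength_eq (e : X ≃ₗ[A] Y) : natLength A X = natLength A Y := by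
  rw [natLength, natLength, e.length_eq]

lemma natLength_eq_zero_iff [Module.Finite A X] : natLength A X = 0 ↔ Subsingleton X := by
  rw [← Module.length_eq_zero_iff (R := A), ← coe_natLength]
  exact_mod_cast Iff.rfl

lemma natLength_pos [Module.Finite A X] [Nontrivial X] : 0 < natLength A X := by
  rw [Nat.pos_iff_ne_zero, Ne, natLength_eq_zero_iff, not_subsingleton_iff_nontrivial]
  infer_instance

lemma eq_top_of_natLength_le [Module.Finite A X] {p : Submodule A X}
    (h : natLength A X ≤ natLength A p) : p = ⊤ := by
  by_contra hp
  have := Submodule.length_lt hp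
  rw [← coe_natLength, ← coe_natLength] at this
  have : natLength A p < natLength A X := by exact_mod_cast this
  omega

lemma ker_eq_bot_of_natLength_le [Module.Finite A X] (f : X →ₗ[A] Y)
    (h : natLength A X ≤ natLength A (LinearMap.range f)) : LinearMap.ker f = ⊥ := by
  have := natLength_eq_range_add_ker f
  have h0 : natLength A (LinearMap.ker f) = 0 := by omega
  rw [natLength_eq_zero_iff] at h0
  exact Submodule.eq_bot_of_subsingleton

end Length

section Indecomposable

variable (A : Type) [Ring A]

/-- `X` is an indecomposable module: it has exactly two idempotent endomorphisms. -/
def IsIndecModule (X : Type) [AddCommGroup X] [Module A X] : Prop :=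
  Nontrivial X ∧ ∀ e : X →ₗ[A] X, e ∘ₗ e = e → e = 0 ∨ e = LinearMap.id

variable {A}
variable {X Y : Type} [AddCommGroup X] [Module A X] [AddCommGroup Y] [Module A Y]

lemma IsIndecModule.eq_bot_of_isCompl (hX : IsIndecModule A X) {p q : Submodule A X}
    (h : IsCompl p q) : p = ⊥ ∨ q = ⊥ := by
  have hid : p.projection q h ∘ₗ p.projection q h = p.projection q h :=
    Submodule.isIdempotentElem_projection h
  rcases hX.2 _ hid with h0 | h1
  · left
    rw [← Submodule.range_projection h, h0, LinearMap.range_zero]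
  · right
    rw [← Submodule.ker_projection h, h1, LinearMap.ker_id]

variable [IsArtinianRing A]

lemma IsIndecModule.bijective_or_isNilpotent [Module.Finite A X] (hX : IsIndecModule A X)
    (f : Module.End A X) : Function.Bijective f ∨ IsNilpotent f := by
  obtain ⟨k, hk⟩ := Filter.eventually_atTop.mp f.eventually_isCompl_ker_pow_range_pow
  have hk := hk (k + 1) (by omega)
  rcases hX.eq_bot_of_isCompl hk with h | h
  · left
    have hi : Function.Injective f := by
      rw [LinearMap.ker_eq_bot, pow_succ] at h
      exact Function.Injective.of_comp h
    exact IsArtinian.bijective_of_injective_endomorphism f hi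
  · exact Or.inr ⟨k + 1, LinearMap.range_eq_bot.1 h⟩

lemma IsIndecModule.exists_inverse_of_not_bijective [Module.Finite A X] (hX : IsIndecModule A X)
    (f : X →ₗ[A] X) (hf : ¬ Function.Bijective f) :
    ∃ g : X →ₗ[A] X, (LinearMap.id - f) ∘ₗ g = LinearMap.id ∧
      g ∘ₗ (LinearMap.id - f) = LinearMap.id := by
  have hn := (hX.bijective_or_isNilpotent f).resolve_left hf
  obtain ⟨u, hu⟩ := hn.isUnit_one_sub
  refine ⟨u⁻¹.1, ?_, ?_⟩
  · change (1 - f : Module.End A X) * u⁻¹.1 = 1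
    rw [← hu]; simp
  · change u⁻¹.1 * (1 - f : Module.End A X) = 1
    rw [← hu]; simp

lemma IsIndecModule.bijective_of_add_eq_id [Module.Finite A X] (hX : IsIndecModule A X)
    {f g : X →ₗ[A] X} (h : f + g = LinearMap.id) :
    Function.Bijective f ∨ Function.Bijective g := by
  by_contra! hh
  obtain ⟨u, h1, h2⟩ := hX.exists_inverse_of_not_bijective f hh.1
  rw [← h, add_sub_cancel_left] at h1 h2
  refine hh.2 (Function.bijective_iff_has_inverse.2 ⟨u, fun x => ?_, fun x => ?_⟩)
  · exact LinearMap.congr_fun h2 x |>.trans (by simp [h])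
  · exact LinearMap.congr_fun h1 x |>.trans (by simp [h])

omit [IsArtinianRing A] in
/-- A split monomorphism onto an indecomposable module is bijective. -/
lemma IsIndecModule.bijective_of_leftInverse [Nontrivial X] (hY : IsIndecModule A Y)
    (g : X →ₗ[A] Y) (r : Y →ₗ[A] X) (h : r ∘ₗ g = LinearMap.id) : Function.Bijective g := by
  have hr : ∀ x, r (g x) = x := LinearMap.congr_fun h
  have hid : (g ∘ₗ r) ∘ₗ (g ∘ₗ r) = g ∘ₗ r := by
    ext x; simp [hr]
  rcases hY.2 _ hid with h0 | h1
  · obtain ⟨x, hx⟩ := exists_ne (0 : X)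
    refine absurd ?_ hx
    have := LinearMap.congr_fun h0 (g x)
    simp only [LinearMap.comp_apply, hr, LinearMap.zero_apply] at this
    rw [← hr x, this, map_zero]
  · exact Function.bijective_iff_has_inverse.2 ⟨r, hr, LinearMap.congr_fun h1⟩

/-- If `p ∘ f ≠ 0` factors through `B`, it does so through an indecomposable direct summand
of `B`. -/
lemma exists_isIndecModule_retract (B : ModuleCat.{0} A) [Module.Finite A B]
    (b : B →ₗ[A] X) (h : Y →ₗ[A] B) (hbh : b ∘ₗ h ≠ 0) :
    ∃ (C : ModuleCat.{0} A) (i : C →ₗ[A] B) (p : B →ₗ[A] C), p ∘ₗ i = LinearMap.id ∧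
      IsIndecModule A C ∧ b ∘ₗ i ∘ₗ p ∘ₗ h ≠ 0 := by
  let P : ℕ → Prop := fun n => ∃ (C : ModuleCat.{0} A) (i : C →ₗ[A] B) (p : B →ₗ[A] C),
    p ∘ₗ i = LinearMap.id ∧ b ∘ₗ i ∘ₗ p ∘ₗ h ≠ 0 ∧ natLength A C = n
  have hP : ∃ n, P n := ⟨_, B, LinearMap.id, LinearMap.id, rfl, hbh, rfl⟩
  classical
  obtain ⟨C, i, p, hpi, hne, hn⟩ := Nat.find_spec hP
  have hpi' : ∀ x, p (i x) = x := LinearMap.congr_fun hpi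
  have : Module.Finite A C := Module.Finite.of_surjective p (fun x => ⟨i x, hpi' x⟩)
  have key : ∀ e : C →ₗ[A] C, e ∘ₗ e = e → e ≠ LinearMap.id →
      b ∘ₗ i ∘ₗ e ∘ₗ p ∘ₗ h = 0 := by
    intro e he h1
    by_contra h0
    have he' : ∀ x, e (e x) = e x := LinearMap.congr_fun he
    refine h1 ?_
    have hle := Nat.find_min' hP (m := natLength A (LinearMap.range e))
      ⟨ModuleCat.of A (LinearMap.range e), i ∘ₗ (LinearMap.range e).subtype,
        e.rangeRestrict ∘ₗ p, ?_, ?_, rfl⟩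
    · rw [← hn] at hle
      have ht := eq_top_of_natLength_le hle
      ext x
      obtain ⟨y, rfl⟩ := LinearMap.range_eq_top.1 ht x
      simp [he']
    · ext ⟨x, y, rfl⟩
      simp [hpi', he']
    · exact h0
  refine ⟨C, i, p, hpi, ⟨?_, fun e he => ?_⟩, hne⟩
  · by_contra hC
    rw [not_nontrivial_iff_subsingleton] at hC
    refine hne ?_
    ext x
    simp [Subsingleton.elim (p (h x)) 0]
  · by_contra! hh
    have he' : ∀ x, e (e x) = e x := LinearMap.congr_fun he
    have h1 := key e he hh.2
    have h2 := key (LinearMap.id - e) (by ext x; simp [he'])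
      (fun h => hh.1 (by simpa using h))
    refine hne ?_
    rw [LinearMap.sub_comp, LinearMap.comp_sub, LinearMap.comp_sub, h1, sub_zero] at h2
    exact h2

end Indecomposable

section HaradaSai

variable {A : Type} [Ring A]

/-- `f` is a composition of `m` non-isomorphisms between indecomposable modules of length at
most `b`. -/
def IsRadComp (b : ℕ) : ℕ → ∀ X Y : ModuleCat.{0} A, (X →ₗ[A] Y) → Prop
  | 0, X, Y, f => (Module.Finite A X ∧ IsIndecModule A X ∧ natLength A X ≤ b) ∧
      (Module.Finite A Y ∧ IsIndecModule A Y ∧ natLength A Y ≤ b) ∧ Function.Bijective f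
  | m + 1, X, Y, f => (Module.Finite A X ∧ IsIndecModule A X ∧ natLength A X ≤ b) ∧
      ∃ (Z : ModuleCat.{0} A) (g : X →ₗ[A] Z) (h : Z →ₗ[A] Y),
        ¬ Function.Bijective g ∧ IsRadComp b m Z Y h ∧ f = h ∘ₗ g

lemma IsRadComp.source {b m : ℕ} {X Y : ModuleCat.{0} A} {f : X →ₗ[A] Y}
    (h : IsRadComp b m X Y f) :
    Module.Finite A X ∧ IsIndecModule A X ∧ natLength A X ≤ b := by
  cases m with
  | zero => exact h.1
  | succ m => exact h.1

lemma IsRadComp.split {b : ℕ} (p : ℕ) {q : ℕ} {X Y : ModuleCat.{0} A} {f : X →ₗ[A] Y}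
    (h : IsRadComp b (q + p) X Y f) :
    ∃ (Z : ModuleCat.{0} A) (g : X →ₗ[A] Z) (k : Z →ₗ[A] Y),
      IsRadComp b p X Z g ∧ IsRadComp b q Z Y k ∧ f = k ∘ₗ g := by
  induction p generalizing X with
  | zero => exact ⟨X, LinearMap.id, f, ⟨h.source, h.source, Function.bijective_id⟩, h, rfl⟩
  | succ p ih =>
    obtain ⟨hX, W, u, v, hu, hv, rfl⟩ := h
    obtain ⟨Z, g, k, hg, hk, rfl⟩ := ih hv
    exact ⟨Z, g ∘ₗ u, k, ⟨hX, W, u, g, hu, hg, rfl⟩, hk, rfl⟩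

variable [IsArtinianRing A]

lemma isCompl_range_ker_of_natLength_le {X Y Z : Type} [AddCommGroup X] [Module A X]
    [AddCommGroup Y] [Module A Y] [AddCommGroup Z] [Module A Z] [Module.Finite A Y]
    (f : X →ₗ[A] Y) (g : Y →ₗ[A] Z)
    (hf : natLength A (LinearMap.range f) ≤ natLength A (LinearMap.range (g ∘ₗ f)))
    (hg : natLength A (LinearMap.range g) ≤ natLength A (LinearMap.range (g ∘ₗ f))) :
    IsCompl (LinearMap.range f) (LinearMap.ker g) := by
  constructor
  · have hr : LinearMap.range (g ∘ₗ (LinearMap.range f).subtype) = LinearMap.range (g ∘ₗ f) := by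
      rw [LinearMap.range_comp, LinearMap.range_comp, Submodule.range_subtype]
    have := ker_eq_bot_of_natLength_le (g ∘ₗ (LinearMap.range f).subtype) (by rwa [hr])
    rw [LinearMap.ker_comp] at this
    rw [disjoint_iff, eq_bot_iff]
    rintro y ⟨hy, hy'⟩
    have hm : (⟨y, hy⟩ : LinearMap.range f) ∈
        (LinearMap.ker g).comap (LinearMap.range f).subtype := hy'
    rw [this, Submodule.mem_bot] at hm
    exact congrArg Subtype.val hm
  · have hle : LinearMap.range (g ∘ₗ f) ≤ LinearMap.range g := LinearMap.range_comp_le_range f g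
    have ht := eq_top_of_natLength_le (X := LinearMap.range g)
      (p := (LinearMap.range (g ∘ₗ f)).submoduleOf (LinearMap.range g))
      (by rwa [(Submodule.submoduleOfEquivOfLe hle).natLength_eq])
    rw [codisjoint_iff, eq_top_iff]
    intro y _
    have hy : (⟨g y, y, rfl⟩ : LinearMap.range g) ∈
        (LinearMap.range (g ∘ₗ f)).submoduleOf (LinearMap.range g) := by rw [ht]; trivial
    obtain ⟨x, hx⟩ := hy
    rw [Submodule.mem_sup]
    refine ⟨f x, ⟨x, rfl⟩, y - f x, ?_, by abel⟩
    rw [LinearMap.mem_ker, map_sub, sub_eq_zero]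
    exact hx.symm

/-- The Harada–Sai lemma. -/
theorem IsRadComp.eq_zero_or_natLength_range {b : ℕ} (k : ℕ) {X Y : ModuleCat.{0} A}
    {f : X →ₗ[A] Y} (h : IsRadComp b (2 ^ k - 1) X Y f) :
    f = 0 ∨ natLength A (LinearMap.range f) + k ≤ b := by
  induction k generalizing X Y with
  | zero =>
    obtain ⟨⟨_, _, hX⟩, -, -⟩ := h
    right
    have := natLength_le_of_surjective f.rangeRestrict f.surjective_rangeRestrict
    omega
  | succ k ih =>
    by_contra! hcon
    obtain ⟨hne, hlt⟩ := hcon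
    have hm : 2 ^ (k + 1) - 1 = ((2 ^ k - 1) + 1) + (2 ^ k - 1) := by
      have := Nat.one_le_two_pow (n := k)
      rw [pow_succ]; omega
    rw [hm] at h
    obtain ⟨W, f₀, F, hf₀, ⟨⟨_, hW, -⟩, V, g, h₀, hg, hh₀, rfl⟩, rfl⟩ := h.split
    obtain ⟨_, hV, -⟩ := hh₀.source
    obtain ⟨_, -, -⟩ := hf₀.source
    have h1 := (ih hf₀).resolve_left (by rintro rfl; simp at hne)
    have h2 := (ih hh₀).resolve_left (by rintro rfl; simp at hne)
    have hrank_comp_right : ∀ {P Q R : ModuleCat.{0} A} (u : P →ₗ[A] Q) (v : Q →ₗ[A] R)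
        [Module.Finite A Q],
        natLength A (LinearMap.range (v ∘ₗ u)) ≤ natLength A (LinearMap.range v) :=
      fun u v _ => natLength_le_of_injective _
        (Submodule.inclusion_injective (LinearMap.range_comp_le_range u v))
    have hrank_comp_left : ∀ {P Q R : ModuleCat.{0} A} (u : P →ₗ[A] Q) (v : Q →ₗ[A] R)
        [Module.Finite A P],
        natLength A (LinearMap.range (v ∘ₗ u)) ≤ natLength A (LinearMap.range u) := by
      intro P Q R u v _
      rw [LinearMap.range_comp]
      exact natLength_le_of_surjective (v.submoduleMap _) (v.submoduleMap_surjective _)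
    have h3 := hrank_comp_left f₀ (h₀ ∘ₗ g)
    have h4 := hrank_comp_right f₀ (h₀ ∘ₗ g)
    have h5 := hrank_comp_right g h₀
    have h6 := hrank_comp_left f₀ g
    have h7 := hrank_comp_right (g ∘ₗ f₀) h₀
    rw [← LinearMap.comp_assoc] at h7
    have cW := isCompl_range_ker_of_natLength_le f₀ (h₀ ∘ₗ g) (by omega) (by omega)
    have cV := isCompl_range_ker_of_natLength_le (g ∘ₗ f₀) h₀
      (by rw [← LinearMap.comp_assoc]; omega) (by rw [← LinearMap.comp_assoc]; omega)
    have k1 := (hW.eq_bot_of_isCompl cW).resolve_left (by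
      intro h; rw [LinearMap.range_eq_bot] at h; exact hne (by rw [h, LinearMap.comp_zero]))
    have k2 := (hV.eq_bot_of_isCompl cV).resolve_left (by
      intro h; rw [LinearMap.range_eq_bot] at h
      exact hne (by rw [LinearMap.comp_assoc, h, LinearMap.comp_zero]))
    refine hg ⟨?_, ?_⟩
    · exact Function.Injective.of_comp (LinearMap.ker_eq_bot.1 k1)
    · rw [k2] at cV
      have ht := eq_top_of_isCompl_bot cV
      rw [LinearMap.range_eq_top] at ht
      exact Function.Surjective.of_comp ht

end HaradaSai

section TraceForm

variable {K : Type} [Field K] {A : Type} [Ring A] [Algebra K A] [FiniteDimensional K A]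
variable {M Z : Type} [AddCommGroup M] [Module A M] [Module K M] [IsScalarTower K A M]
  [AddCommGroup Z] [Module A Z] [Module K Z] [IsScalarTower K A Z]

/-- Every linear form on `Hom(M, Z)` is given by composing with a map `Z → M` and taking the
trace. -/
lemma exists_eq_trace_comp {V W : Type} [AddCommGroup V] [Module K V] [FiniteDimensional K V]
    [AddCommGroup W] [Module K W] (Φ : (V →ₗ[K] W) →ₗ[K] K) :
    ∃ ψ : W →ₗ[K] V, ∀ h, Φ h = LinearMap.trace K V (ψ ∘ₗ h) := by
  let m := Module.finBasis K V
  refine ⟨∑ i, (Φ ∘ₗ LinearMap.smulRightₗ (m.coord i)).smulRight (m i), fun h => ?_⟩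
  have hh : h = ∑ i, (m.coord i).smulRight (h (m i)) := by
    refine m.ext fun j => ?_
    simp [Finsupp.single_apply]
  have hc : (∑ i, (Φ ∘ₗ LinearMap.smulRightₗ (m.coord i)).smulRight (m i)) ∘ₗ h =
      ∑ i, (Φ ∘ₗ LinearMap.smulRightₗ (m.coord i) ∘ₗ h).smulRight (m i) := by
    ext x; simp
  rw [hc, map_sum]
  simp only [LinearMap.trace_smulRight]
  conv_lhs => rw [hh]
  rw [map_sum]
  rfl

lemma eq_zero_of_trace_comp_eq_zero {V W : Type} [AddCommGroup V] [Module K V]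
    [FiniteDimensional K V] [AddCommGroup W] [Module K W]
    (ρ : W →ₗ[K] V) (h : ∀ f : V →ₗ[K] W, LinearMap.trace K V (ρ ∘ₗ f) = 0) : ρ = 0 := by
  ext w
  refine (Module.forall_dual_apply_eq_zero_iff K (ρ w)).1 fun μ => ?_
  have hc : ρ ∘ₗ μ.smulRight w = μ.smulRight (ρ w) := by
    ext x; simp
  rw [← LinearMap.trace_smulRight, ← hc, h]

omit [FiniteDimensional K A] in
/-- A map which is trace-orthogonal to all `A`-linear maps is a sum of commutators with the
elements of a basis of `A`. -/
lemma exists_commutators_of_trace_comp_eq_zero [FiniteDimensional K M] [FiniteDimensional K Z]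
    {ι : Type} [Fintype ι] (a : Module.Basis ι K A) (ρ : Z →ₗ[K] M)
    (h : ∀ f : M →ₗ[A] Z, LinearMap.trace K M (ρ ∘ₗ f.restrictScalars K) = 0) :
    ∃ ψ : ι → (Z →ₗ[K] M), ∀ z, ρ z = ∑ j, (ψ j (a j • z) - a j • ψ j z) := by
  classical
  let δ : (M →ₗ[K] Z) →ₗ[K] (ι → (M →ₗ[K] Z)) :=
    { toFun := fun f j => Algebra.lsmul K K Z (a j) ∘ₗ f - f ∘ₗ Algebra.lsmul K K M (a j)
      map_add' := fun f g => by ext; simp; abel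
      map_smul' := fun c f => by ext j x; simp [smul_sub, smul_comm (a j) c (f x)] }
  have hδ : ∀ f, δ f = 0 → ∃ f' : M →ₗ[A] Z, f'.restrictScalars K = f := by
    intro f hf
    have hj : ∀ j x, a j • f x = f (a j • x) := fun j x => by
      have := LinearMap.congr_fun (congrFun hf j) x
      simpa [δ, sub_eq_zero] using this
    refine ⟨{ f with map_smul' := fun b x => ?_ }, rfl⟩
    change f (b • x) = b • f x
    rw [← a.sum_repr b]
    simp only [Finset.sum_smul, map_sum, smul_assoc, map_smul, hj]
  let Φ : (M →ₗ[K] Z) →ₗ[K] K := LinearMap.trace K M ∘ₗ LinearMap.llcomp K M Z M ρ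
  have hΦ : Φ ∈ LinearMap.range δ.dualMap := by
    rw [LinearMap.range_dualMap_eq_dualAnnihilator_ker, Submodule.mem_dualAnnihilator]
    intro f hf
    obtain ⟨f', rfl⟩ := hδ f hf
    exact h f'
  obtain ⟨Ψ, hΨ⟩ := hΦ
  choose ψ hψ using fun j => exists_eq_trace_comp (Ψ ∘ₗ LinearMap.single K (fun _ => M →ₗ[K] Z) j)
  refine ⟨ψ, fun z => ?_⟩
  let σ : Z →ₗ[K] M := ∑ j, (ψ j ∘ₗ Algebra.lsmul K K Z (a j) - Algebra.lsmul K K M (a j) ∘ₗ ψ j)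
  have hσ : ρ - σ = 0 := by
    refine eq_zero_of_trace_comp_eq_zero _ fun f => ?_
    have h1 : LinearMap.trace K M (ρ ∘ₗ f) = Ψ (δ f) := by
      rw [← LinearMap.dualMap_apply, hΨ]; rfl
    have h2 : Ψ (δ f) = ∑ j, LinearMap.trace K M (ψ j ∘ₗ δ f j) := by
      simp_rw [← hψ]
      conv_lhs => rw [← Finset.univ_sum_single (δ f)]
      rw [map_sum]
      rfl
    have h3 : σ ∘ₗ f = ∑ j, (ψ j ∘ₗ Algebra.lsmul K K Z (a j) -
        Algebra.lsmul K K M (a j) ∘ₗ ψ j) ∘ₗ f := by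
      ext; simp [σ]
    rw [LinearMap.sub_comp, map_sub, h1, h2, h3, map_sum, ← Finset.sum_sub_distrib]
    refine Finset.sum_eq_zero fun j _ => ?_
    change LinearMap.trace K M
      (ψ j ∘ₗ (Algebra.lsmul K K Z (a j) ∘ₗ f - f ∘ₗ Algebra.lsmul K K M (a j))) - _ = 0
    rw [LinearMap.comp_sub, LinearMap.sub_comp, map_sub, map_sub, sub_eq_zero]
    congr 1
    exact LinearMap.trace_comp_comm' (Algebra.lsmul K K M (a j)) (ψ j ∘ₗ f)
  have := LinearMap.congr_fun (sub_eq_zero.1 hσ) z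
  simpa [σ] using this

/-- For an indecomposable module there is a trace form on its endomorphisms which kills the radical
but not the identity. -/
lemma IsIndecModule.exists_trace_form [FiniteDimensional K M] (hM : IsIndecModule A M) :
    ∃ θ : M →ₗ[K] M, LinearMap.trace K M θ ≠ 0 ∧ ∀ f : M →ₗ[A] M, ¬ Function.Bijective f →
      LinearMap.trace K M (θ ∘ₗ f.restrictScalars K) = 0 := by
  have : IsArtinianRing A := IsArtinianRing.of_finite K A
  have : Module.Finite A M := Module.Finite.of_restrictScalars_finite K A M
  have := hM.1
  let p : Submodule K (M →ₗ[K] M) :=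
    { carrier := {x | ∃ f : M →ₗ[A] M, ¬ Function.Bijective f ∧ f.restrictScalars K = x}
      zero_mem' := ⟨0, fun h => by
        obtain ⟨x, hx⟩ := exists_ne (0 : M)
        exact hx (h.1 rfl), rfl⟩
      add_mem' := by
        rintro _ _ ⟨f, hf, rfl⟩ ⟨g, hg, rfl⟩
        refine ⟨f + g, fun h => ?_, rfl⟩
        let e := LinearEquiv.ofBijective (f + g) h
        have he : (e.symm.toLinearMap ∘ₗ f) + (e.symm.toLinearMap ∘ₗ g) = LinearMap.id := by
          rw [← LinearMap.comp_add]
          ext x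
          exact e.symm_apply_apply x
        rcases hM.bijective_of_add_eq_id he with h | h
        · exact hf ((Function.Bijective.of_comp_iff' e.symm.bijective f).1 h)
        · exact hg ((Function.Bijective.of_comp_iff' e.symm.bijective g).1 h)
      smul_mem' := by
        rintro c _ ⟨f, hf, rfl⟩
        rcases eq_or_ne c 0 with rfl | hc
        · refine ⟨0, fun h => ?_, by simp⟩
          obtain ⟨x, hx⟩ := exists_ne (0 : M)
          exact hx (h.1 rfl)
        · refine ⟨c • f, fun h => hf ⟨fun x y hxy => h.1 ?_, fun y => ?_⟩, rfl⟩
          · simp [hxy]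
          · obtain ⟨x, hx⟩ := h.2 (c • y)
            exact ⟨x, smul_right_injective M hc hx⟩ }
  have hp : LinearMap.id ∉ p := by
    rintro ⟨f, hf, h⟩
    apply hf
    have : ⇑f = id := congrArg DFunLike.coe h
    rw [this]
    exact Function.bijective_id
  obtain ⟨Φ, h1, h2⟩ := p.exists_le_ker_of_notMem hp
  obtain ⟨θ, hθ⟩ := exists_eq_trace_comp Φ
  refine ⟨θ, ?_, fun f hf => ?_⟩
  · rw [hθ] at h1; exact h1
  · rw [← hθ]; exact h2 ⟨f, hf, rfl⟩

end TraceForm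

open scoped TensorProduct

section FinrankLength

variable {K : Type} [Field K] {A : Type} [Ring A] [Algebra K A]

lemma natLength_le_finrank {X : Type} [AddCommGroup X] [Module A X] [Module K X]
    [IsScalarTower K A X] [FiniteDimensional K X] : natLength A X ≤ Module.finrank K X := by
  have h : Module.length A X ≤ Module.length K X := by
    rw [← WithBot.coe_le_coe, Module.coe_length, Module.coe_length]
    exact Order.krullDim_le_of_orderEmbedding (Submodule.restrictScalarsEmbedding K A X)
  rw [Module.length_eq_finrank] at h
  exact ENat.toNat_le_of_le_natCast h

lemma finrank_le_mul_natLength [FiniteDimensional K A] {X : Type} [AddCommGroup X] [Module A X]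
    [Module K X] [IsScalarTower K A X] [Module.Finite A X] :
    Module.finrank K X ≤ Module.finrank K A * natLength A X := by
  have : IsArtinianRing A := IsArtinianRing.of_finite K A
  obtain ⟨n, hn⟩ : ∃ n, n = natLength A X := ⟨_, rfl⟩
  induction n using Nat.strong_induction_on generalizing X with
  | _ n ih =>
  have : FiniteDimensional K X := Module.Finite.trans A X
  rcases subsingleton_or_nontrivial X with h | h
  · rw [Module.finrank_zero_of_subsingleton]; exact Nat.zero_le _
  obtain ⟨x, hx⟩ := exists_ne (0 : X)
  let f : A →ₗ[A] X := LinearMap.toSpanSingleton A X x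
  let R := LinearMap.range f
  have : Nontrivial R := ⟨⟨⟨x, 1, by simp [f]⟩, 0, fun h => hx (congrArg Subtype.val h)⟩⟩
  have h1 : natLength A X = natLength A R + natLength A (X ⧸ R) :=
    natLength_eq_add_of_exact R.subtype R.mkQ R.injective_subtype R.mkQ_surjective
      (LinearMap.exact_subtype_mkQ R)
  have h2 : 0 < natLength A R := natLength_pos
  have h3 := ih (natLength A (X ⧸ R)) (by omega) rfl
  have h4 := (R.mkQ.restrictScalars K).finrank_range_add_finrank_ker
  have h5 : LinearMap.range (R.mkQ.restrictScalars K) = ⊤ :=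
    LinearMap.range_eq_top.2 R.mkQ_surjective
  have h6 : LinearMap.ker (R.mkQ.restrictScalars K) = LinearMap.range (f.restrictScalars K) := by
    ext y
    simp [R]
  rw [h5, h6, finrank_top] at h4
  have h7 := LinearMap.finrank_range_le (f.restrictScalars K)
  calc Module.finrank K X ≤ Module.finrank K A * natLength A (X ⧸ R) + Module.finrank K A := by
        omega
    _ = Module.finrank K A * (natLength A (X ⧸ R) + 1) := by ring
    _ ≤ _ := Nat.mul_le_mul_left _ (by omega)

end FinrankLength

section AlmostSplit

variable {K : Type} [Field K] {A : Type} [Ring A] [Algebra K A]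

lemma trace_eq_zero_of_eq_sum_commutators {M : Type} [AddCommGroup M] [Module A M] [Module K M]
    [IsScalarTower K A M] [FiniteDimensional K M] {ι : Type} [Fintype ι] (a : ι → A)
    (θ : M →ₗ[K] M) (ψ : ι → (M →ₗ[K] M))
    (h : ∀ x, θ x = ∑ j, (ψ j (a j • x) - a j • ψ j x)) : LinearMap.trace K M θ = 0 := by
  have hθ : θ = ∑ j, (ψ j ∘ₗ Algebra.lsmul K K M (a j) - Algebra.lsmul K K M (a j) ∘ₗ ψ j) := by
    ext x
    simp [h]
  rw [hθ, map_sum]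
  refine Finset.sum_eq_zero fun j _ => ?_
  rw [map_sub, sub_eq_zero]
  exact LinearMap.trace_comp_comm' _ _

/-- The coinduced module `Hom_K(A, M)`, with `A` acting through right multiplication on the
source. -/
def Coinduced (K A M : Type) [Field K] [Ring A] [Algebra K A] [AddCommGroup M] [Module K M] :
    Type := A →ₗ[K] M

section Coinduced

variable {M : Type} [AddCommGroup M] [Module K M]

instance : AddCommGroup (Coinduced K A M) := inferInstanceAs (AddCommGroup (A →ₗ[K] M))

instance : Module K (Coinduced K A M) := inferInstanceAs (Module K (A →ₗ[K] M))

instance : FunLike (Coinduced K A M) A M := inferInstanceAs (FunLike (A →ₗ[K] M) A M)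

instance : Module A (Coinduced K A M) where
  smul b ξ := LinearMap.comp ξ (LinearMap.mulRight K b)
  one_smul ξ := LinearMap.ext fun x => congrArg ξ (mul_one x)
  mul_smul b c ξ := LinearMap.ext fun x => congrArg ξ (mul_assoc x b c).symm
  smul_zero _ := rfl
  smul_add _ _ _ := rfl
  add_smul b c ξ := LinearMap.ext fun x =>
    (congrArg ξ (mul_add x b c)).trans (LinearMap.map_add ξ _ _)
  zero_smul ξ := LinearMap.ext fun x => (congrArg ξ (mul_zero x)).trans (LinearMap.map_zero ξ)

lemma Coinduced.smul_apply (b : A) (ξ : Coinduced K A M) (x : A) : (b • ξ) x = ξ (x * b) := rfl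

lemma Coinduced.add_apply (ξ η : Coinduced K A M) (x : A) : (ξ + η) x = ξ x + η x := rfl

instance : IsScalarTower K A (Coinduced K A M) where
  smul_assoc c b ξ := LinearMap.ext fun x =>
    (congrArg ξ (mul_smul_comm c x b)).trans (LinearMap.map_smul ξ c _)

/-- A linear map `ψ : Z → M` induces an `A`-linear map from `Z` to the coinduced module. -/
def Coinduced.lift {Z : Type} [AddCommGroup Z] [Module K Z] [Module A Z] [IsScalarTower K A Z]
    (ψ : Z →ₗ[K] M) : Z →ₗ[A] Coinduced K A M where
  toFun z := ψ ∘ₗ (LinearMap.toSpanSingleton A Z z).restrictScalars K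
  map_add' z w := LinearMap.ext fun x =>
    (congrArg ψ (smul_add x z w)).trans (map_add ψ _ _)
  map_smul' b z := LinearMap.ext fun x => congrArg ψ (mul_smul x b z).symm

lemma Coinduced.finrank_eq [FiniteDimensional K A] [FiniteDimensional K M] :
    Module.finrank K (Coinduced K A M) = Module.finrank K A * Module.finrank K M :=
  Module.finrank_linearMap K K A M

instance [FiniteDimensional K A] [FiniteDimensional K M] : FiniteDimensional K (Coinduced K A M) :=
  inferInstanceAs (FiniteDimensional K (A →ₗ[K] M))

end Coinduced

variable (K) in
/-- Existence of right almost split maps in `A`-mod, with a bound on the length of the source. -/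
theorem exists_rightAlmostSplit [FiniteDimensional K A] (M : ModuleCat.{0} A) [Module.Finite A M]
    (hM : IsIndecModule A M) :
    ∃ (B : ModuleCat.{0} A) (b : B →ₗ[A] M), Module.Finite A B ∧
      natLength A B ≤ (1 + Module.finrank K A * Module.finrank K A) * Module.finrank K A *
        natLength A M ∧
      (∀ s : M →ₗ[A] B, b ∘ₗ s ≠ LinearMap.id) ∧
      ∀ (Z : ModuleCat.{0} A) (g : Z →ₗ[A] M), Module.Finite A Z →
        (∀ s : M →ₗ[A] Z, g ∘ₗ s ≠ LinearMap.id) → ∃ h : Z →ₗ[A] B, b ∘ₗ h = g := by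
  have : IsArtinianRing A := IsArtinianRing.of_finite K A
  let _ : Module K M := Module.compHom M (algebraMap K A)
  have : IsScalarTower K A M := IsScalarTower.of_compHom K A M
  have : FiniteDimensional K M := Module.Finite.trans A M
  obtain ⟨θ, hθ, hrad⟩ := hM.exists_trace_form (K := K)
  let a := Module.finBasis K A
  let B : Submodule A (M × (Fin (Module.finrank K A) → Coinduced K A M)) :=
    { carrier := {p | ∀ x : A, θ (x • p.1) = ∑ j, (p.2 j (a j * x) - a j • p.2 j x)}
      zero_mem' := fun x => by
        simp only [Prod.fst_zero, smul_zero, map_zero]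
        refine (Finset.sum_eq_zero fun j _ => ?_).symm
        change (0 : M) - a j • (0 : M) = 0
        simp
      add_mem' := fun {p q} hp hq x => by
        simp only [Prod.fst_add, Prod.snd_add, Pi.add_apply, Coinduced.add_apply, smul_add, map_add,
          hp x, hq x, ← Finset.sum_add_distrib]
        refine Finset.sum_congr rfl fun j _ => ?_
        abel
      smul_mem' := fun c p hp x => by
        have := hp (x * c)
        simp only [Prod.smul_fst, Prod.smul_snd, Pi.smul_apply, Coinduced.smul_apply, smul_smul,
          this, mul_assoc] }
  have hfin : FiniteDimensional K (M × (Fin (Module.finrank K A) → Coinduced K A M)) :=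
    inferInstance
  have : Module.Finite A (M × (Fin (Module.finrank K A) → Coinduced K A M)) :=
    Module.Finite.of_restrictScalars_finite K A _
  refine ⟨ModuleCat.of A B, LinearMap.fst A _ _ ∘ₗ B.subtype, inferInstanceAs (Module.Finite A B),
    ?_, ?_, ?_⟩
  · calc natLength A B ≤ natLength A (M × (Fin (Module.finrank K A) → Coinduced K A M)) :=
          natLength_le_of_injective B.subtype B.injective_subtype
      _ ≤ Module.finrank K (M × (Fin (Module.finrank K A) → Coinduced K A M)) :=
          natLength_le_finrank
      _ = (1 + Module.finrank K A * Module.finrank K A) * Module.finrank K M := by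
          rw [Module.finrank_prod, Module.finrank_pi_fintype]
          simp only [Coinduced.finrank_eq, Finset.sum_const, Finset.card_univ, Fintype.card_fin,
            smul_eq_mul]
          ring
      _ ≤ _ := by
          rw [mul_assoc]
          exact Nat.mul_le_mul_left _ finrank_le_mul_natLength
  · intro s hs
    have hs' : ∀ x, (s x).1.1 = x := LinearMap.congr_fun hs
    refine hθ (trace_eq_zero_of_eq_sum_commutators (A := A) a θ
      (fun j => { toFun := fun x => (s x).1.2 j 1, map_add' := ?_, map_smul' := ?_ }) fun x => ?_)
    · intro x y; rw [map_add]; rfl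
    · intro c x
      have : s (c • x) = (algebraMap K A c) • s x := by
        rw [← map_smul, algebraMap_smul]
      rw [this]
      change (s x).1.2 j (1 * algebraMap K A c) = c • (s x).1.2 j 1
      rw [one_mul, Algebra.algebraMap_eq_smul_one]
      exact LinearMap.map_smul ((s x).1.2 j) c 1
    · have h1 := (s x).2 1
      rw [one_smul, hs'] at h1
      rw [h1]
      refine Finset.sum_congr rfl fun j _ => ?_
      simp only [LinearMap.coe_mk, AddHom.coe_mk, map_smul]
      change _ = (s x).1.2 j (1 * a j) - _
      rw [one_mul, mul_one]
  · intro Z g hZ hg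
    let _ : Module K Z := Module.compHom Z (algebraMap K A)
    have : IsScalarTower K A Z := IsScalarTower.of_compHom K A Z
    have : FiniteDimensional K Z := Module.Finite.trans A Z
    obtain ⟨ψ, hψ⟩ := exists_commutators_of_trace_comp_eq_zero a (θ ∘ₗ g.restrictScalars K)
      (fun f => hrad (g ∘ₗ f) fun hbij => by
        let e := LinearEquiv.ofBijective _ hbij
        exact hg (f ∘ₗ e.symm.toLinearMap) (LinearMap.ext fun x => e.apply_symm_apply x))
    refine ⟨(g.prod (LinearMap.pi fun j => Coinduced.lift (ψ j))).codRestrict B fun z x => ?_, rfl⟩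
    have := hψ (x • z)
    simp only [LinearMap.comp_apply, LinearMap.coe_restrictScalars, map_smul] at this
    refine this.trans (Finset.sum_congr rfl fun j _ => ?_)
    rw [smul_smul]
    rfl

/-- Existence of left almost split maps in `A`-mod. -/
theorem exists_leftAlmostSplit (K : Type) [Field K] {A : Type} [Ring A] [Algebra K A]
    [FiniteDimensional K A] (X : ModuleCat.{0} A) [Module.Finite A X]
    (hX : IsIndecModule A X) :
    ∃ (E : ModuleCat.{0} A) (u : X →ₗ[A] E), Module.Finite A E ∧
      (∀ r : E →ₗ[A] X, r ∘ₗ u ≠ LinearMap.id) ∧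
      ∀ (Z : ModuleCat.{0} A) (g : X →ₗ[A] Z), Module.Finite A Z →
        (∀ r : Z →ₗ[A] X, r ∘ₗ g ≠ LinearMap.id) → ∃ h : E →ₗ[A] Z, h ∘ₗ u = g := by
  let _ : Module K X := Module.compHom X (algebraMap K A)
  have : IsScalarTower K A X := IsScalarTower.of_compHom K A X
  have : FiniteDimensional K X := Module.Finite.trans A X
  obtain ⟨θ, hθ, hrad⟩ := hX.exists_trace_form (K := K)
  let a := Module.finBasis K A
  let rel : X → X × (Fin (Module.finrank K A) → A ⊗[K] X) := fun x =>
    (θ x, fun j => a j ⊗ₜ[K] x - 1 ⊗ₜ[K] (a j • x))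
  let R : Submodule A (X × (Fin (Module.finrank K A) → A ⊗[K] X)) :=
    Submodule.span A (Set.range rel)
  refine ⟨ModuleCat.of A ((X × (Fin (Module.finrank K A) → A ⊗[K] X)) ⧸ R),
    R.mkQ ∘ₗ LinearMap.inl A _ _,
    inferInstanceAs (Module.Finite A ((X × (Fin (Module.finrank K A) → A ⊗[K] X)) ⧸ R)), ?_, ?_⟩
  · intro r hr
    have hr' : ∀ x, r (R.mkQ (x, 0)) = x := LinearMap.congr_fun hr
    let q : (Fin (Module.finrank K A) → A ⊗[K] X) →ₗ[A] X := r ∘ₗ R.mkQ ∘ₗ LinearMap.inr A _ _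
    refine hθ (trace_eq_zero_of_eq_sum_commutators (A := A) a θ
      (fun j => (q.restrictScalars K) ∘ₗ LinearMap.single K _ j ∘ₗ TensorProduct.mk K A X 1)
      fun x => ?_)
    have h0 : R.mkQ (rel x) = 0 := by
      rw [Submodule.mkQ_apply, Submodule.Quotient.mk_eq_zero]
      exact Submodule.subset_span ⟨x, rfl⟩
    have h1 : rel x = (θ x, 0) + LinearMap.inr A _ _ (rel x).2 := by simp [rel]
    have h2 : θ x + q (rel x).2 = 0 := by
      rw [← hr' (θ x)]
      change r _ + r _ = 0
      rw [← map_add]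
      change r (R.mkQ _ + R.mkQ _) = 0
      rw [← map_add, ← h1, h0, map_zero]
    rw [eq_neg_of_add_eq_zero_left h2, ← map_neg, ← Finset.univ_sum_single (-(rel x).2), map_sum]
    refine Finset.sum_congr rfl fun j _ => ?_
    simp only [LinearMap.comp_apply, LinearMap.coe_restrictScalars, LinearMap.single_apply,
      TensorProduct.mk_apply]
    rw [← map_smul, ← map_sub, ← Pi.single_smul, ← Pi.single_sub, TensorProduct.smul_tmul']
    simp [rel]
  · intro Z g hZ hg
    let _ : Module K Z := Module.compHom Z (algebraMap K A)
    have : IsScalarTower K A Z := IsScalarTower.of_compHom K A Z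
    have : FiniteDimensional K Z := Module.Finite.trans A Z
    obtain ⟨ψ, hψ⟩ := exists_commutators_of_trace_comp_eq_zero a (g.restrictScalars K ∘ₗ θ)
      (fun f => by
        rw [LinearMap.comp_assoc, LinearMap.trace_comp_comm', LinearMap.comp_assoc]
        refine hrad (f ∘ₗ g) fun hbij => ?_
        let e := LinearEquiv.ofBijective _ hbij
        exact hg (e.symm.toLinearMap ∘ₗ f) (LinearMap.ext fun x => e.symm_apply_apply x))
    let l : Fin (Module.finrank K A) → (A ⊗[K] X →ₗ[A] Z) := fun j =>
      TensorProduct.AlgebraTensorModule.lift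
        { toFun := fun x => Algebra.lsmul K K Z x ∘ₗ ψ j
          map_add' := fun x y => by ext; simp
          map_smul' := fun x y => by ext; simp }
    let L : (X × (Fin (Module.finrank K A) → A ⊗[K] X)) →ₗ[A] Z :=
      g.coprod (∑ j, l j ∘ₗ LinearMap.proj j)
    have hL : R ≤ LinearMap.ker L := by
      rw [Submodule.span_le]
      rintro _ ⟨x, rfl⟩
      have := hψ x
      simp only [LinearMap.comp_apply, LinearMap.coe_restrictScalars] at this
      rw [SetLike.mem_coe, LinearMap.mem_ker]
      simp [L, rel, l, this]
    refine ⟨R.liftQ L hL, ?_⟩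
    ext x
    simp [L]

end AlmostSplit

section Diagrams

variable {A : Type} [Ring A]

lemma LinearMap.exists_comp_eq_of_ker_le {E V Z : Type} [AddCommGroup E] [Module A E]
    [AddCommGroup V] [Module A V] [AddCommGroup Z] [Module A Z] (p : E →ₗ[A] Z)
    (hp : Function.Surjective p) (φ : E →ₗ[A] V) (h : LinearMap.ker p ≤ LinearMap.ker φ) :
    ∃ ψ : Z →ₗ[A] V, ψ ∘ₗ p = φ := by
  refine ⟨(LinearMap.ker p).liftQ φ h ∘ₗ (p.quotKerEquivOfSurjective hp).symm.toLinearMap, ?_⟩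
  ext e
  have : (p.quotKerEquivOfSurjective hp).symm (p e) = Submodule.Quotient.mk e := by
    rw [LinearEquiv.symm_apply_eq]; rfl
  simp [this]

lemma LinearMap.exists_comp_eq_of_range_le {E V Z : Type} [AddCommGroup E] [Module A E]
    [AddCommGroup V] [Module A V] [AddCommGroup Z] [Module A Z] (i : Z →ₗ[A] E)
    (hi : Function.Injective i) (φ : V →ₗ[A] E) (h : LinearMap.range φ ≤ LinearMap.range i) :
    ∃ ψ : V →ₗ[A] Z, i ∘ₗ ψ = φ := by
  refine ⟨(LinearEquiv.ofInjective i hi).symm.toLinearMap ∘ₗ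
    φ.codRestrict (LinearMap.range i) fun v => h ⟨v, rfl⟩, ?_⟩
  ext v
  exact congrArg Subtype.val ((LinearEquiv.ofInjective i hi).apply_symm_apply _)

/-- Pushouts of modules, with the description of their elements. -/
lemma exists_pushout {K X E : Type} [AddCommGroup K] [Module A K] [AddCommGroup X] [Module A X]
    [AddCommGroup E] [Module A E] (a : K →ₗ[A] X) (b : K →ₗ[A] E) :
    ∃ (P : ModuleCat.{0} A) (i : X →ₗ[A] P) (j : E →ₗ[A] P), i ∘ₗ a = j ∘ₗ b ∧
      (∀ p, ∃ x e, p = i x + j e) ∧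
      (∀ x e, i x + j e = 0 → ∃ k, x = a k ∧ e = - b k) ∧
      ∀ (T : ModuleCat.{0} A) (φ : X →ₗ[A] T) (ψ : E →ₗ[A] T), φ ∘ₗ a = ψ ∘ₗ b →
        ∃ χ : P →ₗ[A] T, χ ∘ₗ i = φ ∧ χ ∘ₗ j = ψ := by
  let R : Submodule A (X × E) := LinearMap.range (a.prod (-b))
  refine ⟨ModuleCat.of A ((X × E) ⧸ R), R.mkQ ∘ₗ LinearMap.inl A X E,
    R.mkQ ∘ₗ LinearMap.inr A X E, ?_, fun p => ?_, fun x e h => ?_, fun T φ ψ h => ?_⟩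
  · ext k
    exact (Submodule.Quotient.eq R).2 ⟨k, by simp⟩
  · obtain ⟨⟨x, e⟩, rfl⟩ := R.mkQ_surjective p
    refine ⟨x, e, ?_⟩
    change _ = R.mkQ (x, 0) + R.mkQ (0, e)
    rw [← map_add]; simp
  · change R.mkQ (x, 0) + R.mkQ (0, e) = 0 at h
    rw [← map_add, Submodule.mkQ_apply, Submodule.Quotient.mk_eq_zero] at h
    obtain ⟨k, hk⟩ := h
    refine ⟨k, ?_, ?_⟩
    · simpa using (congrArg Prod.fst hk).symm
    · simpa using (congrArg Prod.snd hk).symm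
  · refine ⟨R.liftQ (φ.coprod ψ) ?_, ?_, ?_⟩
    · rintro _ ⟨k, rfl⟩
      have := LinearMap.congr_fun h k
      simp only [LinearMap.comp_apply] at this
      simp [this]
    · ext x; simp
    · ext x; simp

/-- A retract is a direct factor. -/
def LinearEquiv.prodKerOfRetract {X Y : Type} [AddCommGroup X] [Module A X] [AddCommGroup Y]
    [Module A Y] (i : X →ₗ[A] Y) (p : Y →ₗ[A] X) (h : p ∘ₗ i = LinearMap.id) :
    Y ≃ₗ[A] X × LinearMap.ker p :=
  have h' : ∀ x, p (i x) = x := LinearMap.congr_fun h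
  { p.prod ((LinearMap.id - i ∘ₗ p).codRestrict (LinearMap.ker p) fun y => by simp [h']) with
    invFun := fun z => i z.1 + z.2
    left_inv := fun y => by simp
    right_inv := fun z => by ext <;> simp [h'] }

end Diagrams

section Resolving

variable {A : Type} [Ring A]

/-- Functorially finite resolving subcategories, in terms of linear maps. -/
structure IsFFResolving (Ω : ModuleCat.{0} A → Prop) : Prop where
  finite : ∀ X, Ω X → Module.Finite A X
  of_retract : ∀ (X Y : ModuleCat.{0} A) (i : X →ₗ[A] Y) (p : Y →ₗ[A] X),
    p ∘ₗ i = LinearMap.id → Ω Y → Ω X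
  of_exact : ∀ (X Y Z : ModuleCat.{0} A) (f : X →ₗ[A] Y) (g : Y →ₗ[A] Z),
    Function.Injective f → Function.Surjective g → Function.Exact f g → Ω X → Ω Z → Ω Y
  self : Ω (ModuleCat.of A A)
  ker : ∀ (X Y : ModuleCat.{0} A) (f : X →ₗ[A] Y), Function.Surjective f → Ω X → Ω Y →
    Ω (ModuleCat.of A (LinearMap.ker f))
  rightApprox : ∀ Y : ModuleCat.{0} A, Module.Finite A Y →
    ∃ (X : ModuleCat.{0} A) (f : X →ₗ[A] Y), Ω X ∧
      ∀ Z : ModuleCat.{0} A, Ω Z → ∀ g : Z →ₗ[A] Y, ∃ h : Z →ₗ[A] X, f ∘ₗ h = g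
  leftApprox : ∀ X : ModuleCat.{0} A, Module.Finite A X →
    ∃ (Y : ModuleCat.{0} A) (f : X →ₗ[A] Y), Ω Y ∧
      ∀ Z : ModuleCat.{0} A, Ω Z → ∀ g : X →ₗ[A] Z, ∃ h : Y →ₗ[A] Z, h ∘ₗ f = g

lemma Resolving.isFFResolving {Ω : ModuleCat.{0} A → Prop} (hres : Resolving Ω)
    (hsub : IsSubcat Ω) (hff : FunctoriallyFinite Ω) : IsFFResolving Ω where
  finite := hsub.1
  of_retract X Y i p h hY := by
    refine hsub.2.2.2 Y X (ModuleCat.of A (LinearMap.ker p)) ?_ hY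
    exact (LinearEquiv.prodKerOfRetract i p h).toModuleIso ≪≫
      (ModuleCat.biprodIsoProd X (ModuleCat.of A (LinearMap.ker p))).symm
  of_exact X Y Z f g hf hg hfg hX hZ :=
    hres.1 X Y Z (ModuleCat.ofHom f) (ModuleCat.ofHom g) ⟨hf, hg, hfg⟩ hX hZ
  self := hres.2.1
  ker X Y f hf hX hY :=
    hres.2.2 X Y _ (ModuleCat.ofHom f) (ModuleCat.ofHom (LinearMap.ker f).subtype) hX hY hf
      (LinearMap.ker f).injective_subtype (LinearMap.exact_subtype_ker_map f)
  rightApprox Y hY := by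
    obtain ⟨X, f, hX, h⟩ := hff.1 Y hY
    refine ⟨X, f.hom, hX, fun Z hZ g => ?_⟩
    obtain ⟨k, hk⟩ := h Z hZ (ModuleCat.ofHom g)
    exact ⟨k.hom, congrArg ModuleCat.Hom.hom hk⟩
  leftApprox Y hY := by
    obtain ⟨X, f, hX, h⟩ := hff.2 Y hY
    refine ⟨X, f.hom, hX, fun Z hZ g => ?_⟩
    obtain ⟨k, hk⟩ := h Z hZ (ModuleCat.ofHom g)
    exact ⟨k.hom, congrArg ModuleCat.Hom.hom hk⟩

variable {Ω : ModuleCat.{0} A → Prop}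

lemma IsFFResolving.of_subsingleton (hΩ : IsFFResolving Ω) (X : ModuleCat.{0} A)
    [Subsingleton X] : Ω X :=
  hΩ.of_retract X (ModuleCat.of A A) 0 0 (LinearMap.ext fun _ => Subsingleton.elim _ _) hΩ.self

lemma IsFFResolving.free (hΩ : IsFFResolving Ω) (n : ℕ) : Ω (ModuleCat.of A (Fin n → A)) := by
  induction n with
  | zero => exact hΩ.of_subsingleton _
  | succ n ih =>
    have h : Ω (ModuleCat.of A (A × (Fin n → A))) :=
      hΩ.of_exact (ModuleCat.of A A) _ (ModuleCat.of A (Fin n → A)) (LinearMap.inl A A (Fin n → A))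
        (LinearMap.snd A A (Fin n → A)) LinearMap.inl_injective LinearMap.snd_surjective
        Function.Exact.inl_snd hΩ.self ih
    let e : (A × (Fin n → A)) ≃ₗ[A] (Fin (n + 1) → A) := Fin.consLinearEquiv A fun _ => A
    exact hΩ.of_retract _ (ModuleCat.of A (A × (Fin n → A))) e.symm.toLinearMap e.toLinearMap
      (LinearMap.ext fun x => e.apply_symm_apply x) h

/-- Right `Ω`-approximations, in terms of linear maps. -/
def IsApprox (Ω : ModuleCat.{0} A → Prop) {X : ModuleCat.{0} A} {Y : Type} [AddCommGroup Y]
    [Module A Y] (f : X →ₗ[A] Y) : Prop :=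
  Ω X ∧ ∀ Z : ModuleCat.{0} A, Ω Z → ∀ g : Z →ₗ[A] Y, ∃ h : Z →ₗ[A] X, f ∘ₗ h = g

/-- `Y` has a right `Ω`-approximation of length at most `c`. -/
def HasApprox (Ω : ModuleCat.{0} A → Prop) (Y : Type) [AddCommGroup Y] [Module A Y] (c : ℕ) :
    Prop :=
  ∃ (X : ModuleCat.{0} A) (f : X →ₗ[A] Y), natLength A X ≤ c ∧ IsApprox Ω f

variable {Y : Type} [AddCommGroup Y] [Module A Y]

lemma HasApprox.mono {c d : ℕ} (h : HasApprox Ω Y c) (hcd : c ≤ d) : HasApprox Ω Y d :=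
  let ⟨X, f, hX, hf⟩ := h
  ⟨X, f, hX.trans hcd, hf⟩

lemma HasApprox.of_equiv {c : ℕ} {Y' : Type} [AddCommGroup Y'] [Module A Y']
    (h : HasApprox Ω Y c) (e : Y ≃ₗ[A] Y') : HasApprox Ω Y' c := by
  obtain ⟨X, f, hX, hf, hl⟩ := h
  refine ⟨X, e.toLinearMap ∘ₗ f, hX, hf, fun Z hZ g => ?_⟩
  obtain ⟨k, hk⟩ := hl Z hZ (e.symm.toLinearMap ∘ₗ g)
  refine ⟨k, ?_⟩
  rw [LinearMap.comp_assoc, hk]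
  ext z
  exact e.apply_symm_apply _

lemma IsApprox.surjective (hΩ : IsFFResolving Ω) {X : ModuleCat.{0} A} {f : X →ₗ[A] Y}
    (hf : IsApprox Ω f) : Function.Surjective f := fun y => by
  obtain ⟨h, hh⟩ := hf.2 _ hΩ.self (LinearMap.toSpanSingleton A Y y)
  exact ⟨h 1, by simpa using LinearMap.congr_fun hh 1⟩

variable [IsArtinianRing A]

lemma HasApprox.exists_minimal (hΩ : IsFFResolving Ω) {c : ℕ} (h : HasApprox Ω Y c) :
    ∃ (X : ModuleCat.{0} A) (f : X →ₗ[A] Y), natLength A X ≤ c ∧ IsApprox Ω f ∧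
      ∀ σ : X →ₗ[A] X, f ∘ₗ σ = f → Function.Bijective σ := by
  classical
  have hex : ∃ m, HasApprox Ω Y m := ⟨c, h⟩
  obtain ⟨X, f, hX, hf⟩ := Nat.find_spec hex
  refine ⟨X, f, hX.trans (Nat.find_min' hex h), hf, fun σ hσ => ?_⟩
  have := hΩ.finite X hf.1
  have hpow : ∀ k : ℕ, f ∘ₗ (σ ^ k : Module.End A X) = f := fun k => by
    induction k with
    | zero => rfl
    | succ k ih =>
      rw [pow_succ, Module.End.mul_eq_comp, ← LinearMap.comp_assoc, ih, hσ]
  obtain ⟨k, hk⟩ := Filter.eventually_atTop.mp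
    (LinearMap.eventually_isCompl_ker_pow_range_pow (R := A) σ)
  have hk := hk (k + 1) (by omega)
  let R := LinearMap.range (σ ^ (k + 1) : Module.End A X)
  have hR : HasApprox Ω Y (natLength A R) := by
    refine ⟨ModuleCat.of A R, f ∘ₗ R.subtype, le_rfl, hΩ.of_retract _ X R.subtype
      (R.projectionOnto _ hk.symm) ?_ hf.1, fun Z hZ g => ?_⟩
    · ext x
      simp
    · obtain ⟨l, hl⟩ := hf.2 Z hZ g
      refine ⟨LinearMap.rangeRestrict (σ ^ (k + 1) : Module.End A X) ∘ₗ l, ?_⟩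
      conv_rhs => rw [← hl, ← hpow (k + 1)]
      rfl
  have htop : R = ⊤ := eq_top_of_natLength_le (hX.trans (Nat.find_min' hex hR))
  have hs : Function.Surjective (σ ^ (k + 1) : Module.End A X) := LinearMap.range_eq_top.1 htop
  refine IsNoetherian.bijective_of_surjective_endomorphism σ ?_
  rw [pow_succ'] at hs
  exact Function.Surjective.of_comp hs

end Resolving

section BoundedApproximations

variable {A : Type} [Ring A] {Ω : ModuleCat.{0} A → Prop}

/-- Wakamatsu's lemma: morphisms from `Ω` lift along epimorphisms whose kernel is that of a
right minimal right `Ω`-approximation. -/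
lemma IsApprox.exists_lift (hΩ : IsFFResolving Ω) {X : ModuleCat.{0} A} {Y : Type}
    [AddCommGroup Y] [Module A Y] {f : X →ₗ[A] Y} (hf : IsApprox Ω f)
    (hmin : ∀ σ : X →ₗ[A] X, f ∘ₗ σ = f → Function.Bijective σ)
    {V W : Type} [AddCommGroup V] [Module A V] [AddCommGroup W] [Module A W]
    (j : LinearMap.ker f →ₗ[A] V) (π : V →ₗ[A] W) (hj : Function.Injective j)
    (hπ : Function.Surjective π) (hjπ : Function.Exact j π)
    (Z : ModuleCat.{0} A) (hZ : Ω Z) (g : Z →ₗ[A] W) : ∃ h : Z →ₗ[A] V, π ∘ₗ h = g := by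
  let E : Submodule A (V × Z) :=
    LinearMap.ker (π ∘ₗ LinearMap.fst A V Z - g ∘ₗ LinearMap.snd A V Z)
  have hE : ∀ e : E, π e.1.1 = g e.1.2 := fun e => sub_eq_zero.1 e.2
  let p : E →ₗ[A] Z := LinearMap.snd A V Z ∘ₗ E.subtype
  have hp : Function.Surjective p := fun z => by
    obtain ⟨v, hv⟩ := hπ (g z)
    exact ⟨⟨(v, z), sub_eq_zero.2 hv⟩, rfl⟩
  have hπj : ∀ k, π (j k) = 0 := fun k => (hjπ (j k)).2 ⟨k, rfl⟩
  let b : LinearMap.ker f →ₗ[A] E := (LinearMap.inl A V Z ∘ₗ j).codRestrict E fun k => by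
    simp [E, hπj]
  obtain ⟨P, i, l, hil, hgen, hker, huniv⟩ := exists_pushout (LinearMap.ker f).subtype b
  have hil' : ∀ k : LinearMap.ker f, i k = l (b k) := LinearMap.congr_fun hil
  obtain ⟨q, hqi, hql⟩ := huniv Z 0 p (LinearMap.ext fun _ => rfl)
  have hqi' : ∀ x, q (i x) = 0 := LinearMap.congr_fun hqi
  have hql' : ∀ e, q (l e) = p e := LinearMap.congr_fun hql
  have hP : Ω P := by
    refine hΩ.of_exact X P Z i q ?_ ?_ ?_ hf.1 hZ
    · rw [injective_iff_map_eq_zero]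
      intro x hx
      obtain ⟨k, rfl, hk⟩ := hker x 0 (by simp [hx])
      have : b k = 0 := by rw [eq_comm, neg_eq_zero] at hk; exact hk
      have : j k = 0 := congrArg (fun e => e.1.1) this
      rw [hj (this.trans (map_zero j).symm)]
      rfl
    · intro z
      obtain ⟨e, rfl⟩ := hp z
      exact ⟨l e, hql' e⟩
    · intro y
      refine ⟨fun hy => ?_, fun ⟨x, hx⟩ => hx ▸ hqi' x⟩
      obtain ⟨x, e, rfl⟩ := hgen y
      rw [map_add, hqi', hql', zero_add] at hy
      have h0 : π e.1.1 = 0 := by rw [hE]; exact (congrArg g hy).trans (map_zero g)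
      obtain ⟨k, hk⟩ := (hjπ _).1 h0
      refine ⟨x + k, ?_⟩
      have : e = b k := Subtype.ext (Prod.ext hk.symm hy)
      rw [map_add, this, hil']
  obtain ⟨t, hti, htl⟩ := huniv (ModuleCat.of A Y) f 0 (by ext k; simp)
  obtain ⟨s, hs⟩ := hf.2 P hP t
  have hbij := hmin (s ∘ₗ i) (by rw [← LinearMap.comp_assoc, hs]; exact hti)
  let σ := LinearEquiv.ofBijective _ hbij
  have hσ : ∀ x, f (σ.symm x) = f x := fun x => by
    conv_rhs => rw [← σ.apply_symm_apply x]
    change _ = (f ∘ₗ s) (i _)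
    rw [hs]
    exact (LinearMap.congr_fun hti _).symm
  have hsl : ∀ e, f (s (l e)) = 0 := fun e => by
    change (f ∘ₗ s) (l e) = 0
    rw [hs]
    exact LinearMap.congr_fun htl e
  let ρ : E →ₗ[A] LinearMap.ker f := (σ.symm.toLinearMap ∘ₗ s ∘ₗ l).codRestrict _ fun e => by
    simp [hσ, hsl]
  have hρ : ∀ k, ρ (b k) = k := fun k => by
    refine Subtype.ext ?_
    change σ.symm (s (l (b k))) = k
    rw [← hil']
    exact σ.symm_apply_apply k
  obtain ⟨h, hh⟩ := LinearMap.exists_comp_eq_of_ker_le p hp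
    (LinearMap.fst A V Z ∘ₗ E.subtype - j ∘ₗ ρ) fun e he => by
      have h0 : π e.1.1 = 0 := by
        rw [hE]; exact (congrArg g (LinearMap.mem_ker.1 he)).trans (map_zero g)
      obtain ⟨k, hk⟩ := (hjπ _).1 h0
      obtain rfl : e = b k := Subtype.ext (Prod.ext hk.symm he)
      simp [hρ, ← hk]
  refine ⟨h, ?_⟩
  ext z
  obtain ⟨e, rfl⟩ := hp z
  have := LinearMap.congr_fun hh e
  simp only [LinearMap.comp_apply] at this ⊢
  rw [this]
  simp [hπj, hE, p]

variable [IsArtinianRing A]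

/-- A horseshoe lemma for right `Ω`-approximations. -/
lemma HasApprox.of_exact (hΩ : IsFFResolving Ω) {Y₁ Y Y₂ : Type} [AddCommGroup Y₁] [Module A Y₁]
    [AddCommGroup Y] [Module A Y] [AddCommGroup Y₂] [Module A Y₂] (i : Y₁ →ₗ[A] Y) (p : Y →ₗ[A] Y₂)
    (hi : Function.Injective i) (hp : Function.Surjective p) (hip : Function.Exact i p) {c₁ c₂ : ℕ}
    (h₁ : HasApprox Ω Y₁ c₁) (h₂ : HasApprox Ω Y₂ c₂) : HasApprox Ω Y (c₁ + c₂) := by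
  obtain ⟨X₁, f₁, hX₁, hf₁, hmin⟩ := h₁.exists_minimal hΩ
  obtain ⟨X₂, f₂, hX₂, hf₂⟩ := h₂
  have hf₁s := hf₁.surjective hΩ
  have := hΩ.finite X₂ hf₂.1
  have hpi : ∀ y, p (i y) = 0 := fun y => (hip _).2 ⟨y, rfl⟩
  let W : Submodule A (Y × X₂) :=
    LinearMap.ker (p ∘ₗ LinearMap.fst A Y X₂ - f₂ ∘ₗ LinearMap.snd A Y X₂)
  have hW : ∀ w : W, p w.1.1 = f₂ w.1.2 := fun w => sub_eq_zero.1 w.2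
  obtain ⟨n, e, he⟩ := Module.Finite.exists_fin' A X₂
  have hpW : Function.Surjective (LinearMap.snd A Y X₂ ∘ₗ W.subtype) := fun x => by
    obtain ⟨y, hy⟩ := hp (f₂ x)
    exact ⟨⟨(y, x), sub_eq_zero.2 hy⟩, rfl⟩
  obtain ⟨l, hl⟩ := Module.projective_lifting_property (LinearMap.snd A Y X₂ ∘ₗ W.subtype) e hpW
  have hl' : ∀ q, (l q).1.2 = e q := LinearMap.congr_fun hl
  have hQ : Ω (ModuleCat.of A (LinearMap.ker e)) :=
    hΩ.ker (ModuleCat.of A (Fin n → A)) X₂ e he (hΩ.free n) hf₂.1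
  obtain ⟨μ, hμ⟩ := LinearMap.exists_comp_eq_of_range_le i hi
    (LinearMap.fst A Y X₂ ∘ₗ W.subtype ∘ₗ l ∘ₗ (LinearMap.ker e).subtype) (by
      rintro _ ⟨q, rfl⟩
      refine (hip _).1 ?_
      change p (l q).1.1 = 0
      rw [hW, hl', q.2, map_zero])
  obtain ⟨ν, hν⟩ := hf₁.2 _ hQ μ
  have hν' : ∀ q : LinearMap.ker e, i (f₁ (ν q)) = (l q).1.1 := fun q =>
    (congrArg i (LinearMap.congr_fun hν q)).trans (LinearMap.congr_fun hμ q)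
  let a : X₁ →ₗ[A] W := (LinearMap.inl A Y X₂ ∘ₗ i ∘ₗ f₁).codRestrict W fun x => by
    simp [W, hpi]
  obtain ⟨V, r, s, hrs, hgen, hker, huniv⟩ := exists_pushout ν (LinearMap.ker e).subtype
  have hrs' : ∀ q : LinearMap.ker e, r (ν q) = s q := LinearMap.congr_fun hrs
  obtain ⟨χ, hχr, hχs⟩ := huniv (ModuleCat.of A W) a l (LinearMap.ext fun q =>
    Subtype.ext (Prod.ext (hν' q) ((hl' q).trans q.2).symm))
  have hχr' : ∀ x, χ (r x) = a x := LinearMap.congr_fun hχr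
  have hχs' : ∀ x, χ (s x) = l x := LinearMap.congr_fun hχs
  have hr : Function.Injective r := by
    rw [injective_iff_map_eq_zero]
    intro x hx
    obtain ⟨k, rfl, hk⟩ := hker x 0 (by simp [hx])
    have : k = 0 := Subtype.ext (neg_eq_zero.1 hk.symm)
    rw [this]
    exact map_zero ν
  have hexact : ∀ v, (χ v).1.2 = 0 → ∃ x, r x = v := fun v hv => by
    obtain ⟨x, q, rfl⟩ := hgen v
    rw [map_add, hχr', hχs'] at hv
    have hq : e q = 0 := by rw [← hl', ← hv]; exact (zero_add _).symm
    refine ⟨x + ν ⟨q, hq⟩, ?_⟩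
    rw [map_add, hrs']
  let τ : V →ₗ[A] X₂ := LinearMap.snd A Y X₂ ∘ₗ W.subtype ∘ₗ χ
  have hτ : Function.Surjective τ := fun x => by
    obtain ⟨q, rfl⟩ := he x
    exact ⟨s q, by simp [τ, hχs', hl']⟩
  have hrτ : Function.Exact r τ := fun v =>
    ⟨fun hv => hexact v hv, fun ⟨x, hx⟩ => by subst hx; exact congrArg (fun w => w.1.2) (hχr' x)⟩
  have hV : Ω V := hΩ.of_exact X₁ V X₂ r τ hr hτ hrτ hf₁.1 hf₂.1
  have := hΩ.finite V hV
  have hχ : Function.Surjective χ := fun w => by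
    obtain ⟨q, hq⟩ := he w.1.2
    obtain ⟨y, hy⟩ := (hip (w.1.1 - (l q).1.1)).1 (by
      rw [map_sub, hW, hW, hl', hq, sub_self])
    obtain ⟨x, rfl⟩ := hf₁s y
    refine ⟨r x + s q, ?_⟩
    rw [map_add, hχr', hχs']
    refine Subtype.ext (Prod.ext ?_ ?_)
    · change i (f₁ x) + (l q).1.1 = w.1.1
      rw [hy, sub_add_cancel]
    · change 0 + (l q).1.2 = w.1.2
      rw [zero_add, hl', hq]
  refine ⟨V, LinearMap.fst A Y X₂ ∘ₗ W.subtype ∘ₗ χ, ?_, hV, fun Z hZ g => ?_⟩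
  · rw [natLength_eq_add_of_exact r τ hr hτ hrτ]
    exact add_le_add hX₁ hX₂
  obtain ⟨h₂, hh₂⟩ := hf₂.2 Z hZ (p ∘ₗ g)
  obtain ⟨h, hh⟩ := hf₁.exists_lift hΩ hmin (r ∘ₗ (LinearMap.ker f₁).subtype) χ
    (hr.comp (LinearMap.ker f₁).injective_subtype) hχ
    (fun v => ⟨fun hv => by
      obtain ⟨x, rfl⟩ := hexact v (by rw [hv]; rfl)
      rw [hχr'] at hv
      have : i (f₁ x) = 0 := congrArg (fun w => w.1.1) hv
      exact ⟨⟨x, hi (this.trans (map_zero i).symm)⟩, rfl⟩,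
    fun ⟨x, hx⟩ => by
      subst hx
      exact (hχr' x).trans (Subtype.ext (Prod.ext ((congrArg i x.2).trans (map_zero i)) rfl))⟩) Z hZ
    ((g.prod h₂).codRestrict W fun z => sub_eq_zero.2 (LinearMap.congr_fun hh₂ z).symm)
  refine ⟨h, ?_⟩
  rw [LinearMap.comp_assoc, LinearMap.comp_assoc, hh]
  rfl

omit [IsArtinianRing A] in
/-- A uniform bound for approximations of the simple quotients of a module of finite length. -/
lemma exists_hasApprox_of_isSimpleModule (hΩ : IsFFResolving Ω) {N : Type} [AddCommGroup N]
    [Module A N] (hN : IsFiniteLength A N) :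
    ∃ c, ∀ (S : Type) [AddCommGroup S] [Module A S] [IsSimpleModule A S] (φ : N →ₗ[A] S),
      φ ≠ 0 → HasApprox Ω S c := by
  induction hN with
  | of_subsingleton =>
    exact ⟨0, fun S _ _ _ φ hφ => (hφ (Subsingleton.elim _ _)).elim⟩
  | @of_simple_quotient M _ _ N _ _ ih =>
    obtain ⟨c, hc⟩ := ih
    have : Module.Finite A (M ⧸ N) := inferInstance
    obtain ⟨X, f, hX, hf⟩ := hΩ.rightApprox (ModuleCat.of A (M ⧸ N)) this
    refine ⟨max c (natLength A X), fun S _ _ _ φ hφ => ?_⟩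
    by_cases h : φ ∘ₗ N.subtype = 0
    · have hle : N ≤ LinearMap.ker φ := fun x hx => LinearMap.congr_fun h ⟨x, hx⟩
      have hne : N.liftQ φ hle ≠ 0 := fun h0 => hφ (by rw [← N.liftQ_mkQ φ hle, h0]; rfl)
      exact (HasApprox.of_equiv ⟨X, f, le_rfl, hX, hf⟩
        (LinearEquiv.ofBijective _ (LinearMap.bijective_of_ne_zero hne))).mono (le_max_right _ _)
    · exact (hc S _ h).mono (le_max_left _ _)

/-- Right `Ω`-approximations can be chosen of length bounded linearly in terms of the length. -/
lemma exists_forall_hasApprox (hΩ : IsFFResolving Ω) :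
    ∃ c, ∀ (Y : Type) [AddCommGroup Y] [Module A Y] [Module.Finite A Y],
      HasApprox Ω Y (c * natLength A Y) := by
  obtain ⟨c, hc⟩ := exists_hasApprox_of_isSimpleModule hΩ
    (isFiniteLength_iff_isNoetherian_isArtinian.2 ⟨inferInstance, inferInstance⟩ :
      IsFiniteLength A A)
  refine ⟨c, fun Y _ _ _ => ?_⟩
  have hY : IsFiniteLength A Y :=
    isFiniteLength_iff_isNoetherian_isArtinian.2 ⟨inferInstance, inferInstance⟩
  induction hY with
  | @of_subsingleton M _ _ _ =>
    refine ⟨ModuleCat.of A M, LinearMap.id, ?_, hΩ.of_subsingleton _, fun Z hZ g => ⟨g, rfl⟩⟩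
    have : natLength A M = 0 := natLength_eq_zero_iff.2 inferInstance
    exact this.trans_le (Nat.zero_le _)
  | @of_simple_quotient M _ _ N _ _ ih =>
    have : Nontrivial (M ⧸ N) := IsSimpleModule.nontrivial A _
    obtain ⟨s, hs⟩ := exists_ne (0 : M ⧸ N)
    have h₁ := hc (M ⧸ N) (LinearMap.toSpanSingleton A (M ⧸ N) s) fun h =>
      hs (by simpa using LinearMap.congr_fun h 1)
    have h₂ := ih inferInstance
    have h := HasApprox.of_exact hΩ N.subtype N.mkQ N.injective_subtype N.mkQ_surjective
      (LinearMap.exact_subtype_mkQ N) h₂ h₁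
    refine h.mono ?_
    rw [natLength_eq_add_of_exact N.subtype N.mkQ N.injective_subtype N.mkQ_surjective
      (LinearMap.exact_subtype_mkQ N), mul_add]
    simp [natLength]

end BoundedApproximations

section FiniteRetracts

variable {A : Type} [Ring A] [IsArtinianRing A]

lemma natLength_ker_lt_of_retract {X Y : Type} [AddCommGroup X] [Module A X] [AddCommGroup Y]
    [Module A Y] [Module.Finite A Y] [Nontrivial X] (i : X →ₗ[A] Y) (p : Y →ₗ[A] X)
    (h : p ∘ₗ i = LinearMap.id) : natLength A (LinearMap.ker p) < natLength A Y := by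
  have hp : Function.Surjective p := fun x => ⟨i x, LinearMap.congr_fun h x⟩
  have : Module.Finite A X := Module.Finite.of_surjective p hp
  have h₁ := natLength_eq_add_of_exact (LinearMap.ker p).subtype p
    (LinearMap.ker p).injective_subtype hp (LinearMap.exact_subtype_ker_map p)
  have h₂ : 0 < natLength A X := natLength_pos
  omega

/-- A finitely generated module has finitely many indecomposable direct summands up to
isomorphism. -/
lemma exists_list_isIndecModule_retract (C : ModuleCat.{0} A) [Module.Finite A C] :
    ∃ L : List (ModuleCat.{0} A), ∀ (M : ModuleCat.{0} A) (r : M →ₗ[A] C) (s : C →ₗ[A] M),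
      IsIndecModule A M → s ∘ₗ r = LinearMap.id → ∃ D ∈ L, Nonempty (M ≃ₗ[A] D) := by
  obtain ⟨n, hn⟩ : ∃ n, n = natLength A C := ⟨_, rfl⟩
  induction n using Nat.strong_induction_on generalizing C with
  | _ n ih =>
  rcases subsingleton_or_nontrivial C with hC | hC
  · refine ⟨[], fun M r s hM hsr => ?_⟩
    obtain ⟨x, hx⟩ := @exists_ne _ hM.1 (0 : M)
    refine (hx ?_).elim
    rw [← LinearMap.id_apply (R := A) x, ← hsr, LinearMap.comp_apply, Subsingleton.elim (r x) 0,
      map_zero]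
  obtain ⟨x, hx⟩ := exists_ne (0 : C)
  obtain ⟨D, i, p, hpi, hD, -⟩ := exists_isIndecModule_retract C (LinearMap.id (R := A) (M := C))
    (LinearMap.id (R := A) (M := C)) fun h => hx (LinearMap.congr_fun h x)
  have hpi' : ∀ x, p (i x) = x := LinearMap.congr_fun hpi
  have := hD.1
  obtain ⟨L, hL⟩ := ih _ (hn ▸ natLength_ker_lt_of_retract i p hpi)
    (ModuleCat.of A (LinearMap.ker p)) rfl
  refine ⟨D :: L, fun M r s hM hsr => ?_⟩
  have := hM.1
  have : Module.Finite A M :=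
    Module.Finite.of_surjective s fun x => ⟨r x, LinearMap.congr_fun hsr x⟩
  have hsum : s ∘ₗ i ∘ₗ p ∘ₗ r + s ∘ₗ (LinearMap.id - i ∘ₗ p) ∘ₗ r = LinearMap.id := by
    rw [← hsr]; ext; simp
  rcases hM.bijective_of_add_eq_id hsum with h | h
  · let e := LinearEquiv.ofBijective _ h
    exact ⟨D, List.mem_cons_self, ⟨LinearEquiv.ofBijective (p ∘ₗ r)
      (hD.bijective_of_leftInverse (p ∘ₗ r) (e.symm.toLinearMap ∘ₗ s ∘ₗ i)
        (LinearMap.ext fun x => e.symm_apply_apply x))⟩⟩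
  · let e := LinearEquiv.ofBijective _ h
    obtain ⟨D', hD', hMD⟩ := hL M
      (((LinearMap.id - i ∘ₗ p) ∘ₗ r).codRestrict (LinearMap.ker p) fun x => by simp [hpi'])
      (e.symm.toLinearMap ∘ₗ s ∘ₗ (LinearMap.ker p).subtype) hM (by
        rw [LinearMap.comp_assoc, LinearMap.comp_assoc, LinearMap.subtype_comp_codRestrict]
        exact LinearMap.ext fun x => e.symm_apply_apply x)
    exact ⟨D', List.mem_cons_of_mem _ hD', hMD⟩

end FiniteRetracts

section RelativeAlmostSplit

variable {A : Type} [Ring A] {Ω : ModuleCat.{0} A → Prop}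

/-- Right almost split maps in `Ω`, in terms of linear maps. -/
def IsRightAlmostSplit (Ω : ModuleCat.{0} A → Prop) {B M : ModuleCat.{0} A} (b : B →ₗ[A] M) :
    Prop :=
  Ω B ∧ (∀ s : M →ₗ[A] B, b ∘ₗ s ≠ LinearMap.id) ∧
    ∀ (Z : ModuleCat.{0} A) (g : Z →ₗ[A] M), Ω Z → (∀ s : M →ₗ[A] Z, g ∘ₗ s ≠ LinearMap.id) →
      ∃ h : Z →ₗ[A] B, b ∘ₗ h = g

/-- There is a map `X → M` which is irreducible in `Ω`. -/
def HasIrreducible (Ω : ModuleCat.{0} A → Prop) (X M : ModuleCat.{0} A) : Prop :=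
  ∃ g : X →ₗ[A] M, (∀ r : M →ₗ[A] X, r ∘ₗ g ≠ LinearMap.id) ∧
    ∀ (C : ModuleCat.{0} A) (u : X →ₗ[A] C) (v : C →ₗ[A] M), Ω C →
      (∀ r : C →ₗ[A] X, r ∘ₗ u ≠ LinearMap.id) → g = v ∘ₗ u →
      ∃ s : M →ₗ[A] C, v ∘ₗ s = LinearMap.id

lemma HasIrreducible.of_equiv {X X' M : ModuleCat.{0} A} (h : HasIrreducible Ω X M)
    (e : X ≃ₗ[A] X') : HasIrreducible Ω X' M := by
  obtain ⟨g, hg, hfac⟩ := h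
  refine ⟨g ∘ₗ e.symm.toLinearMap, fun r hr => hg (e.symm.toLinearMap ∘ₗ r) ?_,
    fun C u v hC hu hguv => hfac C (u ∘ₗ e.toLinearMap) v hC
      (fun r hr => hu (e.toLinearMap ∘ₗ r) ?_) ?_⟩
  · ext x
    have := LinearMap.congr_fun hr (e x)
    simp only [LinearMap.comp_apply, LinearEquiv.coe_coe, e.symm_apply_apply,
      LinearMap.id_apply] at this
    simp [this]
  · ext x
    have := LinearMap.congr_fun hr (e.symm x)
    simp only [LinearMap.comp_apply, LinearEquiv.coe_coe, e.apply_symm_apply,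
      LinearMap.id_apply] at this
    simp [this]
  · rw [← LinearMap.comp_assoc, ← hguv]
    ext x
    simp

theorem IsFFResolving.exists_isRightAlmostSplit (K : Type) [Field K] [Algebra K A]
    [FiniteDimensional K A] (hΩ : IsFFResolving Ω) :
    ∃ c, ∀ M : ModuleCat.{0} A, Ω M → IsIndecModule A M →
      ∃ (B : ModuleCat.{0} A) (b : B →ₗ[A] M), natLength A B ≤ c * natLength A M ∧
        IsRightAlmostSplit Ω b := by
  have : IsArtinianRing A := IsArtinianRing.of_finite K A
  obtain ⟨c, hc⟩ := exists_forall_hasApprox hΩ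
  refine ⟨c * ((1 + Module.finrank K A * Module.finrank K A) * Module.finrank K A),
    fun M hM hMi => ?_⟩
  have := hΩ.finite M hM
  obtain ⟨B, b, hB, hlen, hb, hfac⟩ := exists_rightAlmostSplit K M hMi
  obtain ⟨X, f, hX, hf⟩ := hc B
  refine ⟨X, b ∘ₗ f, hX.trans ?_, hf.1, fun s hs => hb (f ∘ₗ s) hs, fun Z g hZ hg => ?_⟩
  · rw [mul_assoc]
    exact Nat.mul_le_mul_left _ hlen
  · obtain ⟨h, rfl⟩ := hfac Z g (hΩ.finite Z hZ) hg
    obtain ⟨l, rfl⟩ := hf.2 Z hZ h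
    exact ⟨l, rfl⟩

/-- For `X` indecomposable in `Ω`, up to isomorphism there are only finitely many indecomposable
modules `M` with an irreducible map `X → M` in `Ω`. -/
theorem IsFFResolving.exists_list_hasIrreducible (K : Type) [Field K] [Algebra K A]
    [FiniteDimensional K A] (hΩ : IsFFResolving Ω) (X : ModuleCat.{0} A) (hX : Ω X)
    (hXi : IsIndecModule A X) :
    ∃ L : List (ModuleCat.{0} A), ∀ M : ModuleCat.{0} A, Ω M → IsIndecModule A M →
      HasIrreducible Ω X M → ∃ D ∈ L, Nonempty (M ≃ₗ[A] D) := by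
  have : IsArtinianRing A := IsArtinianRing.of_finite K A
  have := hΩ.finite X hX
  obtain ⟨E, u, hE, hu, hfac⟩ := exists_leftAlmostSplit K X hXi
  obtain ⟨C, f, hC, hf⟩ := hΩ.leftApprox E hE
  have := hΩ.finite C hC
  obtain ⟨L, hL⟩ := exists_list_isIndecModule_retract C
  refine ⟨L, fun M hM hMi ⟨g, hg, hirr⟩ => ?_⟩
  obtain ⟨h, hh⟩ := hfac M g (hΩ.finite M hM) hg
  obtain ⟨v, hv⟩ := hf M hM h
  obtain ⟨s, hs⟩ := hirr C (f ∘ₗ u) v hC (fun r hr => hu (r ∘ₗ f) hr)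
    (by rw [← LinearMap.comp_assoc, hv, hh])
  exact hL M s v hMi hs

/-- A nonzero composition through `M` whose first map is not a split epimorphism is nonzero on an
irreducible map `X → M`. -/
theorem IsRightAlmostSplit.exists_hasIrreducible [IsArtinianRing A] (hΩ : IsFFResolving Ω)
    {B M : ModuleCat.{0} A} {b : B →ₗ[A] M} (hb : IsRightAlmostSplit Ω b) (hM : IsIndecModule A M)
    {Y W : ModuleCat.{0} A} (f : Y →ₗ[A] M) (hY : Ω Y)
    (hf : ∀ s : M →ₗ[A] Y, f ∘ₗ s ≠ LinearMap.id) (w : M →ₗ[A] W) (hwf : w ∘ₗ f ≠ 0) :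
    ∃ (X : ModuleCat.{0} A) (g : X →ₗ[A] M) (h : Y →ₗ[A] X), Ω X ∧ IsIndecModule A X ∧
      natLength A X ≤ natLength A B ∧ ¬ Function.Bijective g ∧ w ∘ₗ g ∘ₗ h ≠ 0 ∧
      HasIrreducible Ω X M := by
  classical
  have hex : ∃ m, ∃ (B : ModuleCat.{0} A) (b : B →ₗ[A] M), natLength A B = m ∧
    IsRightAlmostSplit Ω b := ⟨_, B, b, rfl, hb⟩
  have hle := Nat.find_min' hex ⟨B, b, rfl, hb⟩
  obtain ⟨B', b', hlen, hb'⟩ := Nat.find_spec hex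
  have hmin : ∀ (C : ModuleCat.{0} A) (c : C →ₗ[A] M), IsRightAlmostSplit Ω c →
      natLength A B' ≤ natLength A C := fun C c hc =>
    hlen.trans_le (Nat.find_min' hex ⟨C, c, rfl, hc⟩)
  rw [← hlen] at hle
  clear hlen hex
  have := hΩ.finite B' hb'.1
  obtain ⟨k, rfl⟩ := hb'.2.2 Y f hY hf
  obtain ⟨X, i, p, hpi, hX, hne⟩ := exists_isIndecModule_retract B' (w ∘ₗ b') k hwf
  have hpi' : ∀ x, p (i x) = x := LinearMap.congr_fun hpi
  have hi : Function.Injective i := Function.LeftInverse.injective hpi'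
  have := Module.Finite.of_injective i hi
  have := hX.1
  have hbij : ¬ Function.Bijective (b' ∘ₗ i) := fun h => by
    let e := LinearEquiv.ofBijective _ h
    exact hb'.2.1 (i ∘ₗ e.symm.toLinearMap) (LinearMap.ext fun x => e.apply_symm_apply x)
  refine ⟨X, b' ∘ₗ i, p ∘ₗ k, hΩ.of_retract X B' i p hpi hb'.1, hX,
    (natLength_le_of_injective i hi).trans hle, hbij, hne, b' ∘ₗ i,
    fun r hr => hbij (hM.bijective_of_leftInverse _ r hr), fun C u v hC hu huv => ?_⟩
  by_contra! hv
  obtain ⟨l, rfl⟩ := hb'.2.2 C v hC hv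
  obtain ⟨η, hη, -⟩ := hX.exists_inverse_of_not_bijective (p ∘ₗ l ∘ₗ u) fun h => by
    let e := LinearEquiv.ofBijective _ h
    exact hu (e.symm.toLinearMap ∘ₗ p ∘ₗ l) (LinearMap.ext fun x => e.symm_apply_apply x)
  let ρ : B' →ₗ[A] LinearMap.ker p :=
    (LinearMap.id - i ∘ₗ p).codRestrict _ fun x => by simp [hpi']
  have hρ : ∀ x, x = i (p x) + ρ x := fun x => by simp [ρ]
  have hkey : ∀ x, b' (i x) = b' (ρ (l (u (η x)))) := fun x => by
    have h₁ := LinearMap.congr_fun huv (η x)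
    have h₂ := LinearMap.congr_fun hη x
    simp only [LinearMap.comp_apply, LinearMap.sub_apply, LinearMap.id_apply] at h₁ h₂
    rw [hρ (l (u (η x))), map_add, ← sub_eq_iff_eq_add', ← map_sub, ← map_sub, h₂] at h₁
    exact h₁
  refine (natLength_ker_lt_of_retract i p hpi).not_ge
    (hmin (ModuleCat.of A (LinearMap.ker p)) (b' ∘ₗ (LinearMap.ker p).subtype) ⟨?_, ?_, ?_⟩)
  · refine hΩ.of_retract _ B' (LinearMap.ker p).subtype ρ ?_ hb'.1
    ext x
    simp [ρ]
  · exact fun s hs => hb'.2.1 ((LinearMap.ker p).subtype ∘ₗ s) hs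
  · intro Z g hZ hg
    obtain ⟨h, rfl⟩ := hb'.2.2 Z g hZ hg
    refine ⟨ρ ∘ₗ (l ∘ₗ u ∘ₗ η ∘ₗ p ∘ₗ h + h), ?_⟩
    ext z
    conv_rhs => rw [LinearMap.comp_apply, hρ (h z), map_add, hkey]
    simp

end RelativeAlmostSplit

section Classes

variable {A : Type} [Ring A] {Ω : ModuleCat.{0} A → Prop}

lemma indec_iff_isIndecModule (X : ModuleCat.{0} A) : Indec X ↔ IsIndecModule A X := by
  refine and_congr_right fun _ => ⟨fun h e he => ?_, fun h e he => ?_⟩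
  · refine (h (ModuleCat.ofHom e) (ModuleCat.hom_ext he)).imp ?_ ?_ <;>
    exact fun h => congrArg ModuleCat.Hom.hom h
  · exact (h e.hom (congrArg ModuleCat.Hom.hom he)).imp ModuleCat.hom_ext ModuleCat.hom_ext

lemma IsJHLength.eq_natLength {X : ModuleCat.{0} A} {n : ℕ} (h : IsJHLength X n) :
    n = natLength A X := by
  obtain ⟨s, h₁, h₂, rfl⟩ := h
  rw [natLength, ← Module.length_compositionSeries s h₁ h₂]
  rfl

/-- Isomorphism classes of modules. -/
abbrev ModuleClass (A : Type) [Ring A] : Type 1 :=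
  Quotient (CategoryTheory.isIsomorphicSetoid (ModuleCat.{0} A))

/-- The isomorphism class of a module. -/
def moduleClass (X : ModuleCat.{0} A) : ModuleClass A := Quotient.mk _ X

lemma moduleClass_eq_iff {X Y : ModuleCat.{0} A} :
    moduleClass X = moduleClass Y ↔ Nonempty (X ≃ₗ[A] Y) :=
  Quotient.eq.trans ⟨fun ⟨e⟩ => ⟨e.toLinearEquiv⟩, fun ⟨e⟩ => ⟨e.toModuleIso⟩⟩

/-- The classes of indecomposable modules in `Ω` of length `k`. -/
def indecClasses (Ω : ModuleCat.{0} A → Prop) (k : ℕ) : Set (ModuleClass A) :=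
  {t | ∃ X, Ω X ∧ IsIndecModule A X ∧ natLength A X = k ∧ moduleClass X = t}

lemma mk_indecClasses {len : ModuleCat.{0} A → ℕ} (hlen : ∀ X, Ω X → len X = natLength A X)
    (k : ℕ) : Cardinal.mk (indecClasses Ω k) = numIndecOfLength Ω len k := by
  let φ : Quotient (isoSetoid (fun X => Ω X ∧ Indec X ∧ len X = k)) → ModuleClass A :=
    Quotient.map' Subtype.val fun _ _ h => h
  have hφ : Function.Injective φ := by
    rintro ⟨X⟩ ⟨Y⟩ h
    exact Quotient.sound (s := isoSetoid (fun X => Ω X ∧ Indec X ∧ len X = k))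
      (Quotient.exact (s := CategoryTheory.isIsomorphicSetoid (ModuleCat.{0} A)) h)
  rw [numIndecOfLength, ← Cardinal.mk_range_eq φ hφ]
  congr 2
  ext t
  constructor
  · rintro ⟨X, hX, hXi, hk, rfl⟩
    exact ⟨Quotient.mk _ ⟨X, hX, (indec_iff_isIndecModule X).2 hXi, (hlen X hX).trans hk⟩, rfl⟩
  · rintro ⟨⟨X⟩, rfl⟩
    exact ⟨X.1, X.2.1, (indec_iff_isIndecModule X.1).1 X.2.2.1,
      (hlen X.1 X.2.1).symm.trans X.2.2.2, rfl⟩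

/-- The classes of indecomposable direct summands of `C`. -/
def retractClasses (C : ModuleCat.{0} A) : Set (ModuleClass A) :=
  {t | ∃ (X : ModuleCat.{0} A) (r : X →ₗ[A] C) (s : C →ₗ[A] X), IsIndecModule A X ∧
    s ∘ₗ r = LinearMap.id ∧ moduleClass X = t}

lemma finite_of_exists_list {S : Set (ModuleClass A)} (L : List (ModuleCat.{0} A))
    (h : ∀ t ∈ S, ∃ X, moduleClass X = t ∧ ∃ D ∈ L, Nonempty (X ≃ₗ[A] D)) : S.Finite := by
  classical
  refine ((L.map moduleClass).toFinset.finite_toSet).subset fun t ht => ?_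
  obtain ⟨X, rfl, D, hD, hXD⟩ := h t ht
  simp only [List.coe_toFinset, Set.mem_ofPred_eq, List.mem_map]
  exact ⟨D, hD, (moduleClass_eq_iff.2 hXD).symm⟩

lemma finite_retractClasses [IsArtinianRing A] (C : ModuleCat.{0} A) [Module.Finite A C] :
    (retractClasses C).Finite := by
  obtain ⟨L, hL⟩ := exists_list_isIndecModule_retract C
  refine finite_of_exists_list L ?_
  rintro _ ⟨X, r, s, hX, hsr, rfl⟩
  exact ⟨X, rfl, hL X r s hX hsr⟩

/-- The classes of indecomposable modules in `Ω` which are the target of an irreducible map in `Ω`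
from an indecomposable module of class `t`. -/
def irreducibleClasses (Ω : ModuleCat.{0} A → Prop) (t : ModuleClass A) : Set (ModuleClass A) :=
  {t' | ∃ X M, Ω X ∧ IsIndecModule A X ∧ Ω M ∧ IsIndecModule A M ∧ HasIrreducible Ω X M ∧
    moduleClass X = t ∧ moduleClass M = t'}

lemma IsFFResolving.finite_irreducibleClasses (K : Type) [Field K] [Algebra K A]
    [FiniteDimensional K A] (hΩ : IsFFResolving Ω) (t : ModuleClass A) :
    (irreducibleClasses Ω t).Finite := by
  by_cases h : ∃ X, Ω X ∧ IsIndecModule A X ∧ moduleClass X = t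
  · obtain ⟨X, hX, hXi, rfl⟩ := h
    obtain ⟨L, hL⟩ := hΩ.exists_list_hasIrreducible K X hX hXi
    refine finite_of_exists_list L ?_
    rintro _ ⟨X', M, -, -, hM, hMi, hirr, hXX, rfl⟩
    obtain ⟨e⟩ := moduleClass_eq_iff.1 hXX
    exact ⟨M, rfl, hL M hM hMi (hirr.of_equiv e)⟩
  · convert Set.finite_empty
    rw [Set.eq_empty_iff_forall_notMem]
    rintro _ ⟨X, M, hX, hXi, -, -, -, hXt, -⟩
    exact h ⟨X, hX, hXi, hXt⟩

/-- The classes reached by at most `i` irreducible maps from direct summands of `A` and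
modules of length between `a` and `b`. -/
def reachableClasses (Ω : ModuleCat.{0} A → Prop) (a b : ℕ) : ℕ → Set (ModuleClass A)
  | 0 => retractClasses (ModuleCat.of A A) ∪ ⋃ k ∈ Finset.Icc a b, indecClasses Ω k
  | i + 1 => reachableClasses Ω a b i ∪ ⋃ t ∈ reachableClasses Ω a b i, irreducibleClasses Ω t

lemma reachableClasses_zero_subset (a b i : ℕ) :
    reachableClasses Ω a b 0 ⊆ reachableClasses Ω a b i := by
  induction i with
  | zero => exact subset_rfl
  | succ i ih => exact ih.trans Set.subset_union_left

open Cardinal in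
lemma IsFFResolving.mk_reachableClasses_lt (K : Type) [Field K] [Algebra K A]
    [FiniteDimensional K A] (hΩ : IsFFResolving Ω) {κ : Cardinal.{1}} (hκ : ℵ₀ ≤ κ) {a b : ℕ}
    (h : ∀ k, a ≤ k → #(indecClasses Ω k) < κ) (i : ℕ) : #(reachableClasses Ω a b i) < κ := by
  have : IsArtinianRing A := IsArtinianRing.of_finite K A
  induction i with
  | zero =>
    refine (mk_union_le _ _).trans_lt (add_lt_of_lt hκ
      ((lt_aleph0_iff_set_finite.2 (finite_retractClasses _)).trans_le hκ) ?_)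
    have hs : ∀ s : Finset ℕ, (∀ k ∈ s, a ≤ k) → #(⋃ k ∈ s, indecClasses Ω k : Set _) < κ := by
      intro s
      induction s using Finset.induction_on with
      | empty =>
        intro _
        simpa using aleph0_pos.trans_le hκ
      | insert k s _ ih =>
        intro hs
        rw [Finset.set_biUnion_insert]
        exact (mk_union_le _ _).trans_lt (add_lt_of_lt hκ (h k (hs k (Finset.mem_insert_self k s)))
          (ih fun l hl => hs l (Finset.mem_insert_of_mem hl)))
    exact hs _ fun k hk => (Finset.mem_Icc.1 hk).1
  | succ i ih =>
    refine (mk_union_le _ _).trans_lt (add_lt_of_lt hκ ih ?_)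
    have hF : ∀ t, #(irreducibleClasses Ω t) < ℵ₀ := fun t =>
      lt_aleph0_iff_set_finite.2 (hΩ.finite_irreducibleClasses K t)
    rcases lt_or_ge #(reachableClasses Ω a b i) ℵ₀ with hfin | hinf
    · exact (lt_aleph0_iff_set_finite.2 ((lt_aleph0_iff_set_finite.1 hfin).biUnion fun t _ =>
        hΩ.finite_irreducibleClasses K t)).trans_le hκ
    · refine (mk_biUnion_le _ _).trans_lt (lt_of_le_of_lt ?_ ih)
      exact (mul_le_mul_right (ciSup_le' fun t => (hF _).le) _).trans (mul_aleph0_eq hinf).le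

/-- Below an indecomposable module which is not reachable there are long nonzero compositions
of non-isomorphisms between indecomposable modules of small length. -/
lemma exists_isRadComp [IsArtinianRing A] (hΩ : IsFFResolving Ω) {c N : ℕ}
    (hc : ∀ M : ModuleCat.{0} A, Ω M → IsIndecModule A M →
      ∃ (B : ModuleCat.{0} A) (b : B →ₗ[A] M), natLength A B ≤ c * natLength A M ∧
        IsRightAlmostSplit Ω b)
    {m : ℕ} {M : ModuleCat.{0} A} (hM : Ω M) (hMi : IsIndecModule A M) (hMN : natLength A M < N)
    (hMm : moduleClass M ∉ reachableClasses Ω N (c * N) m) (i : ℕ) (him : i ≤ m) :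
    ∃ (X : ModuleCat.{0} A) (w : X →ₗ[A] M) (h : A →ₗ[A] X), Ω X ∧ IsIndecModule A X ∧
      natLength A X < N ∧ moduleClass X ∉ reachableClasses Ω N (c * N) (m - i) ∧
      IsRadComp N i X M w ∧ w ∘ₗ h ≠ 0 := by
  induction i with
  | zero =>
    have := hMi.1
    obtain ⟨x, hx⟩ := exists_ne (0 : M)
    have hg := And.intro (hΩ.finite M hM) (And.intro hMi hMN.le)
    exact ⟨M, LinearMap.id, LinearMap.toSpanSingleton A M x, hM, hMi, hMN, hMm,
      ⟨hg, hg, Function.bijective_id⟩, fun h => hx (by simpa using LinearMap.congr_fun h 1)⟩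
  | succ i ih =>
    obtain ⟨X, w, h, hX, hXi, hXN, hXm, hw, hwh⟩ := ih (by omega)
    obtain ⟨B, b, hB, hb⟩ := hc X hX hXi
    have hnot : ∀ s : X →ₗ[A] A, h ∘ₗ s ≠ LinearMap.id := fun s hs =>
      hXm (reachableClasses_zero_subset _ _ _ (Or.inl ⟨X, s, h, hXi, hs, rfl⟩))
    obtain ⟨X', g, h', hX', hXi', hXB, hg, hne, hirr⟩ :=
      hb.exists_hasIrreducible hΩ hXi (Y := ModuleCat.of A A) h hΩ.self hnot w hwh
    have hmem : moduleClass X' ∉ reachableClasses Ω N (c * N) (m - (i + 1)) := fun hmem => by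
      refine hXm ?_
      rw [show m - i = m - (i + 1) + 1 by omega]
      exact Or.inr (Set.mem_biUnion hmem ⟨X', X, hX', hXi', hX, hXi, hirr, rfl, rfl⟩)
    have hXN' : natLength A X' < N := by
      by_contra! hN
      refine hmem (reachableClasses_zero_subset _ _ _ (Or.inr (Set.mem_biUnion
        (x := natLength A X') (Finset.mem_coe.2 (Finset.mem_Icc.2 ⟨hN, ?_⟩))
          ⟨X', hX', hXi', rfl, rfl⟩)))
      exact hXB.trans (hB.trans (Nat.mul_le_mul_left _ hXN.le))
    exact ⟨X', w ∘ₗ g, h', hX', hXi', hXN', hmem,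
      ⟨⟨hΩ.finite X' hX', hXi', hXN'.le⟩, X, g, w, hg, hw, rfl⟩, hne⟩

end Classes

/-!
Statement 5 (Brauer–Thrall 1.5 for subcategories): if for some positive integer `n`
there are at least `ℵ₀` isomorphism classes of indecomposable modules in `Ω` of
length `n`, say `𝔑` many, then there are infinitely many positive integers `k` with
at least `𝔑` isomorphism classes of indecomposable modules in `Ω` of length `k`.
-/

theorem stmt_5 {K : Type} [Field K] [IsAlgClosed K]
    {A : Type} [Ring A] [Algebra K A] [FiniteDimensional K A]
    (Ω : ModuleCat.{0} A → Prop)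
    (hsub : IsSubcat Ω) (hff : FunctoriallyFinite Ω) (hres : Resolving Ω)
    (len : ModuleCat.{0} A → ℕ)
    (hlen : ∀ X : ModuleCat.{0} A, Module.Finite A X → IsJHLength X (len X))
    (n : ℕ) (hn : 0 < n)
    (𝔑 : Cardinal) (h𝔑 : 𝔑 = numIndecOfLength Ω len n)
    (hbig : Cardinal.aleph0 ≤ 𝔑) :
    ∀ N : ℕ, ∃ k : ℕ, N ≤ k ∧ 0 < k ∧ 𝔑 ≤ numIndecOfLength Ω len k := by
  intro N₀
  by_contra! hcon
  have hΩ := hres.isFFResolving hsub hff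
  have : IsArtinianRing A := IsArtinianRing.of_finite K A
  have hlen' : ∀ X, Ω X → len X = natLength A X := fun X hX =>
    (hlen X (hΩ.finite X hX)).eq_natLength
  obtain ⟨c, hc⟩ := hΩ.exists_isRightAlmostSplit K
  let N := max N₀ (n + 1)
  let m := 2 ^ N - 1
  have hlt := hΩ.mk_reachableClasses_lt K hbig (a := N) (b := c * N) (fun k hk => by
    rw [mk_indecClasses hlen']
    exact hcon k (by omega) (by omega)) m
  obtain ⟨_, ⟨M, hM, hMi, hMn, rfl⟩, hMm⟩ :
      ∃ t ∈ indecClasses Ω n, t ∉ reachableClasses Ω N (c * N) m := by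
    by_contra! h
    refine hlt.not_ge ?_
    rw [h𝔑, ← mk_indecClasses hlen']
    exact Cardinal.mk_le_mk_of_subset h
  obtain ⟨X, w, h, hX, -, -, -, hw, hwh⟩ :=
    exists_isRadComp hΩ hc hM hMi (N := N) (by omega) hMm m le_rfl
  have := hΩ.finite M hM
  have hw0 : w = 0 := (hw.eq_zero_or_natLength_range N).elim id fun hr => by
    have h0 : natLength A (LinearMap.range w) = 0 := by omega
    rw [natLength_eq_zero_iff, Submodule.subsingleton_iff_eq_bot, LinearMap.range_eq_bot] at h0
    exact h0
  exact hwh (by rw [hw0, LinearMap.zero_comp])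
end

section
/- Let χ be a functorially finite subcategory of A-mod closed under extensions and containing all projective modules, let Z be an indecomposable module in χ admitting a minimal right almost split morphism in χ ending at Z, and let Y be a non-zero module in χ. Then a morphism g : Y → Z is irreducible in χ if and only if there exist a module Y' in χ and a morphism g' : Y' → Z such that the induced morphism (g,g') : Y ⊕ Y' → Z is a minimal right almost split morphism in χ. -/
open CategoryTheory Limits

universe u

/-- The `K`-linear dual of `A`, as a left `A`-module through right multiplication on `A`. -/
structure RegularDual (K A : Type) [Field K] [Ring A] [Algebra K A] where
  toFun : A →ₗ[K] K

namespace RegularDual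
variable {K A : Type} [Field K] [Ring A] [Algebra K A]

/-- The underlying functional. -/
def equiv : RegularDual K A ≃ (A →ₗ[K] K) := ⟨toFun, mk, fun _ => rfl, fun _ => rfl⟩

instance : AddCommGroup (RegularDual K A) := equiv.addCommGroup

instance : Module K (RegularDual K A) := equiv.module K

instance : CoeFun (RegularDual K A) (fun _ => A → K) := ⟨fun l => l.toFun⟩

@[ext] theorem ext {l l' : RegularDual K A} (h : ∀ b, l b = l' b) : l = l' := by
  cases l; cases l'; congr; exact LinearMap.ext h

@[simp] theorem mk_apply (l : A →ₗ[K] K) (b : A) : (mk l) b = l b := rfl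
@[simp] theorem zero_apply (b : A) : (0 : RegularDual K A) b = 0 := rfl
@[simp] theorem add_apply (l l' : RegularDual K A) (b : A) : (l + l') b = l b + l' b := rfl
@[simp] theorem smul_apply (c : K) (l : RegularDual K A) (b : A) : (c • l) b = c * l b := rfl

instance : SMul A (RegularDual K A) := ⟨fun a l => ⟨l.toFun ∘ₗ LinearMap.mulRight K a⟩⟩

@[simp] theorem ring_smul_apply (a : A) (l : RegularDual K A) (b : A) : (a • l) b = l (b * a) := rfl

instance : Module A (RegularDual K A) where
  one_smul l := by ext; simp
  mul_smul a b l := by ext; simp [mul_assoc]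
  smul_zero a := by ext; simp
  smul_add a l l' := by ext; simp
  add_smul a b l := by ext; simp [mul_add]
  zero_smul l := by ext; simp

instance : IsScalarTower K A (RegularDual K A) := ⟨fun c a l => by ext; simp⟩

instance [FiniteDimensional K A] : Module.Finite A (RegularDual K A) :=
  have : Module.Finite K (RegularDual K A) := Module.Finite.equiv (equiv.linearEquiv K).symm
  Module.Finite.of_restrictScalars_finite K A _

end RegularDual

theorem LinearMap.exists_dual_comp_eq {K V W : Type*} [Field K] [AddCommGroup V] [Module K V]
    [AddCommGroup W] [Module K W] (f : V →ₗ[K] W) (l : V →ₗ[K] K) (h : ∀ v, f v = 0 → l v = 0) :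
    ∃ m : W →ₗ[K] K, m ∘ₗ f = l := by
  have : l ∈ LinearMap.range f.dualMap := by
    rw [LinearMap.range_dualMap_eq_dualAnnihilator_ker, Submodule.mem_dualAnnihilator]
    exact fun v hv => h v hv
  exact this

theorem LinearMap.exists_comp_eq_of_ker_le_s6 {R M N P : Type*} [Ring R] [AddCommGroup M] [Module R M]
    [AddCommGroup N] [Module R N] [AddCommGroup P] [Module R P] (p : M →ₗ[R] N)
    (hp : Function.Surjective p) (q : M →ₗ[R] P) (h : LinearMap.ker p ≤ LinearMap.ker q) :
    ∃ r : N →ₗ[R] P, r ∘ₗ p = q := by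
  refine ⟨(LinearMap.ker p).liftQ q h ∘ₗ (p.quotKerEquivOfSurjective hp).symm, ?_⟩
  ext x
  simp [LinearMap.quotKerEquivOfSurjective_symm_apply]

section
variable {K A : Type} [Field K] [Ring A] [Algebra K A] [FiniteDimensional K A]

/-- For a functional `φ` on `End Z`, the functor sending `X` to the maps `f : X → Z` such that
`φ` vanishes on `f ∘ Hom(Z, X)` is a quotient of a representable functor. -/
theorem exists_finite_factor_iff {Z : Type} [AddCommGroup Z] [Module A Z] [Module K Z]
    [IsScalarTower K A Z] [Module.Finite A Z] [SMulCommClass A K Z]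
    (φ : (Z →ₗ[A] Z) →ₗ[K] K) :
    ∃ (E : Type) (_ : AddCommGroup E) (_ : Module A E) (_ : Module.Finite A E) (e : E →ₗ[A] Z),
      ∀ (X : Type) [AddCommGroup X] [Module A X] [Module K X] [IsScalarTower K A X]
        (f : X →ₗ[A] Z),
        (∃ k : X →ₗ[A] E, e ∘ₗ k = f) ↔ ∀ h : Z →ₗ[A] X, φ (f ∘ₗ h) = 0 := by
  have : IsNoetherianRing A := IsNoetherianRing.of_finite K A
  obtain ⟨n, z, hz⟩ := Module.Finite.exists_fin (R := A) (M := Z)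
  let π : (Fin n → A) →ₗ[A] Z := Fintype.linearCombination A z
  have hπ : Function.Surjective π := by
    rw [← LinearMap.range_eq_top, Fintype.range_linearCombination, hz]
  obtain ⟨m, r, hr⟩ := Submodule.fg_iff_exists_fin_generating_family.1
    (IsNoetherian.noetherian (LinearMap.ker π))
  have hrz : ∀ j, ∑ i, r j i • z i = 0 := fun j => by
    have : r j ∈ LinearMap.ker π := hr ▸ Submodule.subset_span ⟨j, rfl⟩
    simpa [π, Fintype.linearCombination_apply] using this
  obtain ⟨ψ, hψ⟩ : ∃ ψ : (Fin n → Z) →ₗ[K] K, ∀ h : Z →ₗ[A] Z, ψ (fun i => h (z i)) = φ h := by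
    let ev : (Z →ₗ[A] Z) →ₗ[K] (Fin n → Z) :=
      { toFun := fun h i => h (z i), map_add' := fun _ _ => rfl, map_smul' := fun _ _ => rfl }
    obtain ⟨ψ, hψ⟩ := ev.exists_dual_comp_eq φ (fun h hh => by
      have : h = 0 := LinearMap.ext_on_range hz fun i => congrFun hh i
      simp [this])
    exact ⟨ψ, fun h => LinearMap.congr_fun hψ h⟩
  let E : Submodule A (Z × (Fin m → RegularDual K A)) :=
    { carrier := {p | ∀ i b, ψ (Pi.single i (b • p.1)) = ∑ j, p.2 j (r j i * b)}
      zero_mem' := by simp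
      add_mem' := by
        intro p q hp hq i b
        simp only [Set.mem_ofPred_eq] at hp hq
        simp [smul_add, Pi.single_add, hp, hq, Finset.sum_add_distrib]
      smul_mem' := by
        intro a p hp i b
        simp only [Set.mem_ofPred_eq] at hp
        simp [smul_smul, hp, mul_assoc] }
  refine ⟨E, inferInstance, inferInstance, inferInstance, LinearMap.fst A _ _ ∘ₗ E.subtype, ?_⟩
  intro X _ _ _ _ f
  have : SMulCommClass A K X := IsScalarTower.to_smulCommClass'
  let fK : (Fin n → X) →ₗ[K] (Fin n → Z) := (f.restrictScalars K).compLeft (Fin n)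
  let R : (Fin n → X) →ₗ[K] (Fin m → X) :=
    { toFun := fun x j => ∑ i, r j i • x i
      map_add' := fun x y => by ext j; simp [Finset.sum_add_distrib]
      map_smul' := fun c x => by
        ext j; simp [Finset.smul_sum, smul_comm _ c] }
  constructor
  · rintro ⟨k, rfl⟩ h
    have key : ∀ x : X, ∀ i, ψ (Pi.single i (k x).1.1) = ∑ j, (k (r j i • x)).1.2 j 1 := by
      intro x i
      have := (k x).2 i 1
      simpa using this
    rw [← hψ]
    have e1 : (fun i => ((LinearMap.fst A _ _ ∘ₗ E.subtype) ∘ₗ k ∘ₗ h) (z i)) =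
        ∑ i, Pi.single i (k (h (z i))).1.1 := by
      rw [Finset.univ_sum_single]; rfl
    rw [LinearMap.comp_assoc, e1, map_sum]
    simp_rw [key]
    rw [Finset.sum_comm]
    refine Finset.sum_eq_zero fun j _ => ?_
    have e2 : ∑ i, k (h (r j i • z i)) = 0 := by
      rw [← map_sum, ← map_sum, hrz, map_zero, map_zero]
    have e3 : ∀ s : Finset (Fin n), ∑ i ∈ s, (k (h (r j i • z i))).1.2 j 1 =
        (∑ i ∈ s, k (h (r j i • z i))).1.2 j 1 := by
      intro s
      induction s using Finset.induction_on with
      | empty => simp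
      | insert a s ha ih => rw [Finset.sum_insert ha, Finset.sum_insert ha, ih]; rfl
    simp_rw [← map_smul h]
    rw [e3, e2]
    simp
  · intro H
    obtain ⟨θ, hθ⟩ := R.exists_dual_comp_eq (ψ ∘ₗ fK) (fun x hx => by
      obtain ⟨h, hh⟩ := LinearMap.exists_comp_eq_of_ker_le_s6 π hπ (Fintype.linearCombination A x) (by
        rw [← hr, Submodule.span_le]
        rintro _ ⟨j, rfl⟩
        simpa [R, Fintype.linearCombination_apply] using congrFun hx j)
      have hx' : ∀ i, h (z i) = x i := fun i => by
        have := LinearMap.congr_fun hh (Pi.single i 1)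
        simpa [π, Fintype.linearCombination_apply_single] using this
      have := H h
      rw [← hψ] at this
      change ψ (fun i => f (x i)) = 0
      simpa [hx'] using this)
    let L : X →ₗ[A] (Fin m → RegularDual K A) :=
      { toFun := fun x j => ⟨θ ∘ₗ LinearMap.single K (fun _ => X) j ∘ₗ
          LinearMap.toSpanSingleton A X x |>.restrictScalars K⟩
        map_add' := fun x y => by ext; simp [Pi.single_add]
        map_smul' := fun a x => by ext; simp [mul_smul] }
    refine ⟨LinearMap.codRestrict E (f.prod L) ?_, rfl⟩
    intro x i b
    have := LinearMap.congr_fun hθ (Pi.single i (b • x))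
    have e1 : R (Pi.single i (b • x)) = ∑ j, Pi.single j ((r j i * b) • x) := by
      rw [Finset.univ_sum_single]
      ext j
      simp [R, Pi.single_apply, mul_smul]
    have e2 : fK (Pi.single i (b • x)) = Pi.single i (b • f x) := by
      ext j
      by_cases hj : j = i
      · subst hj; simp [fK]
      · simp [fK, hj]
    simp only [LinearMap.comp_apply, e1, e2, map_sum] at this
    simpa [L] using this.symm
end

section
variable {A : Type} [Ring A] {χ : ModuleCat.{0} A → Prop}

theorem Indec.isUnit_or_isNilpotent {Z : ModuleCat.{0} A} (hZ : Indec Z) [IsArtinian A Z]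
    [IsNoetherian A Z] (f : Module.End A Z) : IsUnit f ∨ IsNilpotent f := by
  obtain ⟨n, hn, hn0⟩ := (f.eventually_isCompl_ker_pow_range_pow.and
    (Filter.eventually_ne_atTop 0)).exists
  have hidem : ModuleCat.ofHom (Submodule.projection _ _ hn) ≫
      ModuleCat.ofHom (Submodule.projection _ _ hn) =
      ModuleCat.ofHom (Submodule.projection _ _ hn) := by
    ext x
    exact Submodule.projection_apply_of_mem_left hn (Submodule.projection_apply_mem hn x)
  rcases hZ.2 _ hidem with h | h
  · left
    have h0 : Submodule.projection _ _ hn = 0 := congrArg ModuleCat.Hom.hom h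
    have hker : LinearMap.ker (f ^ n) = ⊥ := by
      rw [← Submodule.range_projection hn, h0, LinearMap.range_zero]
    have hrange := hn.sup_eq_top
    rw [hker, bot_sup_eq] at hrange
    rw [← isUnit_pow_iff hn0, Module.End.isUnit_iff]
    exact ⟨LinearMap.ker_eq_bot.1 hker, LinearMap.range_eq_top.1 hrange⟩
  · right
    have h1 : Submodule.projection _ _ hn = LinearMap.id := congrArg ModuleCat.Hom.hom h
    refine ⟨n, LinearMap.ker_eq_top.1 ?_⟩
    rw [← Submodule.range_projection hn, h1, LinearMap.range_id]

/-- A module with local endomorphism ring carries a non-zero functional on its endomorphisms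
that vanishes on the non-units. -/
theorem exists_functional_eq_zero_of_not_isUnit {K Z : Type} [Field K] [Algebra K A]
    [AddCommGroup Z] [Module A Z] [Module K Z] [IsScalarTower K A Z] [SMulCommClass A K Z]
    [Nontrivial Z] (hZ : ∀ f : Module.End A Z, IsUnit f ∨ IsNilpotent f) :
    ∃ φ : Module.End A Z →ₗ[K] K, φ 1 ≠ 0 ∧ ∀ f, ¬ IsUnit f → φ f = 0 := by
  let N : Submodule K (Module.End A Z) :=
    { carrier := {f | IsNilpotent f}
      zero_mem' := IsNilpotent.zero
      add_mem' := by
        intro f g hf hg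
        rcases hZ (f + g) with h | h
        · exfalso
          obtain ⟨u, hu⟩ := h
          have hf' : IsNilpotent (↑u⁻¹ * f) := by
            refine (hZ _).resolve_left fun h => hf.not_isUnit ?_
            simpa using u.isUnit.mul h
          have hsum : (↑u⁻¹ * g : Module.End A Z) = 1 - ↑u⁻¹ * f := by
            rw [eq_sub_iff_add_eq, ← mul_add, add_comm g f, ← hu, Units.inv_mul]
          have hg' : IsUnit (↑u⁻¹ * g : Module.End A Z) := hsum ▸ hf'.isUnit_one_sub
          exact hg.not_isUnit (by simpa using u.isUnit.mul hg')
        · exact h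
      smul_mem' := by
        rintro c f ⟨n, hn⟩
        exact ⟨n, by rw [smul_pow, hn, smul_zero]⟩ }
  have h1 : (1 : Module.End A Z) ∉ N := fun h => IsNilpotent.not_isUnit h isUnit_one
  obtain ⟨φ, hφ, hN⟩ := Submodule.exists_le_ker_of_notMem h1
  exact ⟨φ, hφ, fun f hf => hN ((hZ f).resolve_left hf)⟩

/-- An indecomposable module over a finite-dimensional algebra is the target of a right almost
split morphism in the category of all modules, with finitely generated source. -/
theorem Indec.exists_rightAlmostSplit (K : Type) [Field K] [Algebra K A] [FiniteDimensional K A]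
    {Z : ModuleCat.{0} A} (hZ : Indec Z) [Module.Finite A Z] :
    ∃ (E : ModuleCat.{0} A) (e : E ⟶ Z), Module.Finite A E ∧
      RightAlmostSplitIn (fun _ => True) e := by
  have : IsArtinianRing A := IsArtinianRing.of_finite K A
  have := hZ.1
  let mod (M : ModuleCat.{0} A) : Module K M := Module.restrictScalars K A M
  have tower (M : ModuleCat.{0} A) : IsScalarTower K A M := IsScalarTower.restrictScalars K A M
  have : SMulCommClass A K Z := IsScalarTower.to_smulCommClass'
  obtain ⟨φ, hφ1, hφ⟩ := exists_functional_eq_zero_of_not_isUnit (K := K)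
    hZ.isUnit_or_isNilpotent
  obtain ⟨E, _, _, hE, e, he⟩ := exists_finite_factor_iff φ
  refine ⟨ModuleCat.of A E, ModuleCat.ofHom e, hE, ?_, ?_⟩
  · rintro ⟨⟨s⟩⟩
    refine hφ1 ?_
    have hs : e ∘ₗ s.section_.hom = 1 := congrArg ModuleCat.Hom.hom s.id
    exact (he Z 1).1 ⟨_, hs⟩ 1
  · intro X _ f hf
    obtain ⟨k, hk⟩ := (he X f.hom).2 fun h => hφ _ fun hu => hf <| by
      have : IsIso (ModuleCat.ofHom h ≫ f) :=
        (ConcreteCategory.isIso_iff_bijective _).2 ((Module.End.isUnit_iff _).1 hu)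
      exact ⟨⟨⟨inv (ModuleCat.ofHom h ≫ f) ≫ ModuleCat.ofHom h, by simp⟩⟩⟩
    exact ⟨ModuleCat.ofHom k, ModuleCat.hom_ext hk⟩

theorem RightAlmostSplitIn.comp_rightApprox {E X Z : ModuleCat.{0} A} {e : E ⟶ Z} {p : X ⟶ E}
    (he : RightAlmostSplitIn χ e) (hp : RightApprox χ p) : RightAlmostSplitIn χ (p ≫ e) := by
  refine ⟨fun ⟨⟨s⟩⟩ => he.1 ⟨⟨⟨s.section_ ≫ p, by simp⟩⟩⟩, fun V hV g hg => ?_⟩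
  obtain ⟨k, rfl⟩ := he.2 V hV g hg
  obtain ⟨l, rfl⟩ := hp.2 V hV k
  exact ⟨l, by simp⟩

theorem RightAlmostSplitIn.exists_minimal [IsArtinianRing A] (hsub : IsSubcat χ)
    {X Z : ModuleCat.{0} A} (hX : χ X) {w : X ⟶ Z} (hw : RightAlmostSplitIn χ w) :
    ∃ (W : ModuleCat.{0} A) (v : W ⟶ Z), χ W ∧ MinimalRightAlmostSplitIn χ v := by
  let S : Set ℕ∞ := {l | ∃ (W : ModuleCat.{0} A) (v : W ⟶ Z), χ W ∧ RightAlmostSplitIn χ v ∧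
    Module.length A W = l}
  obtain ⟨_, ⟨W, v, hW, hv, rfl⟩, hmin⟩ :=
    WellFounded.has_min (wellFounded_lt (α := ℕ∞)) S ⟨_, X, w, hX, hw, rfl⟩
  refine ⟨W, v, hW, fun h hh => ?_, hv⟩
  have := hsub.1 W hW
  have hpow : ∀ n : ℕ, ModuleCat.ofHom (h.hom ^ n) ≫ v = v := by
    intro n
    induction n with
    | zero => ext; rfl
    | succ n ih =>
      have : ModuleCat.ofHom (h.hom ^ (n + 1)) = h ≫ ModuleCat.ofHom (h.hom ^ n) := by
        ext; simp [pow_succ]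
      rw [this, Category.assoc, ih, hh]
  obtain ⟨n, hn, hn0⟩ := ((LinearMap.eventually_isCompl_ker_pow_range_pow h.hom).and
    (Filter.eventually_ne_atTop 0)).exists
  set R := LinearMap.range (h.hom ^ n)
  have hfac : ModuleCat.ofHom (h.hom ^ n).rangeRestrict ≫ ModuleCat.ofHom R.subtype =
    ModuleCat.ofHom (h.hom ^ n) := rfl
  have hRχ : χ (ModuleCat.of A R) := hsub.2.2.2 W _ (ModuleCat.of A (LinearMap.ker (h.hom ^ n)))
    ((Submodule.prodEquivOfIsCompl _ _ hn.symm).symm.toModuleIso ≪≫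
      (ModuleCat.biprodIsoProd (ModuleCat.of A R)
        (ModuleCat.of A (LinearMap.ker (h.hom ^ n)))).symm) hW
  have hR : RightAlmostSplitIn χ (ModuleCat.ofHom R.subtype ≫ v) := by
    refine ⟨fun ⟨⟨s⟩⟩ => hv.1 ⟨⟨⟨s.section_ ≫ ModuleCat.ofHom R.subtype, by simp⟩⟩⟩,
      fun V hV g hg => ?_⟩
    obtain ⟨k, rfl⟩ := hv.2 V hV g hg
    refine ⟨k ≫ ModuleCat.ofHom (h.hom ^ n).rangeRestrict, ?_⟩
    rw [Category.assoc, reassoc_of% hfac, hpow]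
  have htop : R = ⊤ := by
    by_contra hne
    exact hmin _ ⟨_, _, hRχ, hR, rfl⟩ (Submodule.length_lt hne)
  have hker : LinearMap.ker (h.hom ^ n) = ⊥ := by
    have := hn.inf_eq_bot
    rwa [htop, inf_top_eq] at this
  have hu : IsUnit (h.hom ^ n) := (Module.End.isUnit_iff _).2
    ⟨LinearMap.ker_eq_bot.1 hker, LinearMap.range_eq_top.1 htop⟩
  exact (ConcreteCategory.isIso_iff_bijective h).2
    ((Module.End.isUnit_iff _).1 ((isUnit_pow_iff hn0).1 hu))

theorem MinimalRightAlmostSplitIn.iso_comp {W V Z : ModuleCat.{0} A} {w : W ⟶ Z}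
    (hw : MinimalRightAlmostSplitIn χ w) (i : V ≅ W) :
    MinimalRightAlmostSplitIn χ (i.hom ≫ w) := by
  refine ⟨fun k hk => ?_, fun ⟨⟨s⟩⟩ => hw.2.1 ⟨⟨⟨s.section_ ≫ i.hom, by simp⟩⟩⟩,
    fun U hU g hg => ?_⟩
  · have : IsIso (i.inv ≫ k ≫ i.hom) := hw.1 _ (by simp [hk])
    have hk' : k = i.hom ≫ (i.inv ≫ k ≫ i.hom) ≫ i.inv := by simp
    rw [hk']
    infer_instance
  · obtain ⟨h, rfl⟩ := hw.2.2 U hU g hg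
    exact ⟨h ≫ i.inv, by simp⟩

theorem IrredIn.exists_biprod_desc (hsub : IsSubcat χ) {W Y Z : ModuleCat.{0} A} {w : W ⟶ Z}
    (hW : χ W) (hw : MinimalRightAlmostSplitIn χ w) (hY : χ Y) {g : Y ⟶ Z} (hg : IrredIn χ g) :
    ∃ (Y' : ModuleCat.{0} A) (_ : χ Y') (g' : Y' ⟶ Z),
      MinimalRightAlmostSplitIn χ (biprod.desc g g') := by
  obtain ⟨h, rfl⟩ := hw.2.2 Y hY g hg.2.1
  have := (hg.2.2 W hW h w rfl).resolve_right hw.2.1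
  obtain ⟨i, hi⟩ : ∃ i : W ≅ Y ⊞ cokernel h, biprod.inl ≫ i.inv = h :=
    ⟨biprod.uniqueUpToIso _ _
      (isBilimitBinaryBiconeOfIsSplitMonoOfCokernel (cokernelIsCokernel h)), biprod.inl_desc _ _⟩
  refine ⟨cokernel h, hsub.2.2.2 W _ Y (i ≪≫ biprod.braiding _ _) hW, biprod.inr ≫ i.inv ≫ w, ?_⟩
  have : biprod.desc (h ≫ w) (biprod.inr ≫ i.inv ≫ w) = i.symm.hom ≫ w := by
    apply biprod.hom_ext' <;> simp [reassoc_of% hi]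
  rw [this]
  exact hw.iso_comp i.symm

theorem MinimalRightAlmostSplitIn.irredIn_of_biprod_desc {Y Y' Z : ModuleCat.{0} A}
    (hZ : Indec Z) (hY : Nontrivial Y) {g : Y ⟶ Z} {g' : Y' ⟶ Z}
    (hg : MinimalRightAlmostSplitIn χ (biprod.desc g g')) : IrredIn χ g := by
  have hepi : ¬ IsSplitEpi g := fun ⟨⟨s⟩⟩ =>
    hg.2.1 ⟨⟨⟨s.section_ ≫ biprod.inl, by simp⟩⟩⟩
  refine ⟨fun ⟨⟨r⟩⟩ => ?_, hepi, fun X hX h t hht => or_iff_not_imp_right.2 fun ht => ?_⟩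
  · rcases hZ.2 (r.retraction ≫ g) (by simp) with h0 | h1
    · have hid : 𝟙 Y = 0 := by
        rw [← r.id, ← cancel_mono (𝟙 Y), ← r.id, Category.assoc, reassoc_of% h0]
        simp
      obtain ⟨y, hy⟩ := exists_ne (0 : Y)
      exact hy (ConcreteCategory.congr_hom hid y)
    · exact hepi ⟨⟨⟨r.retraction, h1⟩⟩⟩
  · obtain ⟨s, hs⟩ := hg.2.2 X hX t ht
    have : IsIso (biprod.desc (h ≫ s) biprod.inr) := hg.1 _ (by
      apply biprod.hom_ext' <;> simp [hs, ← hht])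
    exact ⟨⟨⟨s ≫ inv (biprod.desc (h ≫ s) biprod.inr) ≫ biprod.fst, by
      have : h ≫ s = biprod.inl ≫ biprod.desc (h ≫ s) (biprod.inr : Y' ⟶ Y ⊞ Y') := by simp
      rw [reassoc_of% this]
      simp⟩⟩⟩

end

/-!
Statement 6: a morphism `g : Y → Z` with `Z` indecomposable in `χ` admitting a minimal
right almost split morphism in `χ`, and `Y` a non-zero module in `χ`, is irreducible in
`χ` iff it can be completed to a minimal right almost split morphism
`(g,g') : Y ⊕ Y' → Z` in `χ`.
-/

theorem stmt_6 {K : Type} [Field K] [IsAlgClosed K]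
    {A : Type} [Ring A] [Algebra K A] [FiniteDimensional K A]
    (χ : ModuleCat.{0} A → Prop)
    (hsub : IsSubcat χ) (hff : FunctoriallyFinite χ)
    (hext : ClosedUnderExtensions χ) (hproj : ContainsProjectives χ)
    (Z : ModuleCat.{0} A) (hZχ : χ Z) (hZind : Indec Z)
    -- `Z` admits a minimal right almost split morphism in `χ`
    (hmras : ∃ (W : ModuleCat.{0} A) (w : W ⟶ Z), MinimalRightAlmostSplitIn χ w)
    (Y : ModuleCat.{0} A) (hYχ : χ Y) (hY0 : Nontrivial Y)
    (g : Y ⟶ Z) :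
    IrredIn χ g ↔
      ∃ (Y' : ModuleCat.{0} A) (_ : χ Y') (g' : Y' ⟶ Z),
        MinimalRightAlmostSplitIn χ (biprod.desc g g') := by
  constructor
  · intro hg
    have : IsArtinianRing A := IsArtinianRing.of_finite K A
    have := hsub.1 Z hZχ
    obtain ⟨E, e, hE, he⟩ := hZind.exists_rightAlmostSplit K
    obtain ⟨X, p, hp⟩ := hff.1 E hE
    have heχ : RightAlmostSplitIn χ e := ⟨he.1, fun V _ => he.2 V trivial⟩
    obtain ⟨W, w, hW, hw⟩ := (heχ.comp_rightApprox hp).exists_minimal hsub hp.1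
    exact hg.exists_biprod_desc hsub hW hw hYχ
  · rintro ⟨Y', _, g', hg'⟩
    exact hg'.irredIn_of_biprod_desc hZind hY0
end
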